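/- Let N ≥ 1, s ≥ 1, and let 1 < r < p ≤ ∞ and 1 < q < ∞ satisfy 1/p + 1/q = 1/r. Then there exists a constant C > 0 such that for all u, v ∈ S(ℝ^N): ‖Λ^s(uv)‖_{L^r} ≤ C(‖u‖_{L^p} ‖Λ^s v‖_{L^q} + ‖v‖_{L^p} ‖Λ^s u‖_{L^q}). -/

import Mathlib

open MeasureTheory Filter Topology SchwartzMap
open scoped ENNReal FourierTransform

/-- `Λ^s f = F⁻¹(|ξ|^s F f)`, the Fourier-multiplier definition of the fractional operator. -/
noncomputable def LamF (N : ℕ) (s : ℝ) (f : EuclideanSpace ℝ (Fin N) → ℝ)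
    (x : EuclideanSpace ℝ (Fin N)) : ℝ :=
  (𝓕⁻ (fun ξ : EuclideanSpace ℝ (Fin N) =>
    ((‖ξ‖ ^ s : ℝ) : ℂ) * 𝓕 (fun y => (f y : ℂ)) ξ) x).re

section Geometric

theorem two_rpow_add (x y : ℝ) : (2 : ℝ≥0∞) ^ (x + y) = 2 ^ x * 2 ^ y :=
  ENNReal.rpow_add _ _ two_ne_zero ENNReal.ofNat_ne_top

theorem two_rpow_ne_top (x : ℝ) : (2 : ℝ≥0∞) ^ x ≠ ∞ :=
  ENNReal.rpow_ne_top_of_ne_zero two_ne_zero ENNReal.ofNat_ne_top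

theorem two_rpow_ne_zero (x : ℝ) : (2 : ℝ≥0∞) ^ x ≠ 0 := by
  simp [ENNReal.rpow_eq_zero_iff]

theorem two_rpow_mono {x y : ℝ} (h : x ≤ y) : (2 : ℝ≥0∞) ^ x ≤ 2 ^ y :=
  ENNReal.rpow_le_rpow_of_exponent_le one_le_two h

theorem ofReal_two_rpow (x : ℝ) : ENNReal.ofReal (2 ^ x) = 2 ^ x := by
  rw [← ENNReal.ofReal_rpow_of_pos two_pos]; simp

theorem tsum_two_rpow_neg_ne_top {α : ℝ} (hα : 0 < α) :
    ∑' i : ℕ, (2 : ℝ≥0∞) ^ (-(i * α)) ≠ ∞ := by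
  have h : ∀ i : ℕ, (2 : ℝ≥0∞) ^ (-(i * α)) = (2 ^ (-α)) ^ i := fun i => by
    rw [← ENNReal.rpow_natCast, ← ENNReal.rpow_mul]; congr 1; ring
  simp_rw [h, ENNReal.tsum_geometric]
  refine ENNReal.inv_ne_top.2 (tsub_pos_of_lt ?_).ne'
  exact ENNReal.rpow_lt_one_of_one_lt_of_neg ENNReal.one_lt_two (by linarith)

theorem tsum_int_le_eq {h : ℤ → ℝ≥0∞} (n : ℤ) (hh : ∀ k, n < k → h k = 0) :
    ∑' k, h k = ∑' i : ℕ, h (n - i) := by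
  refine (Function.Injective.tsum_eq (g := fun i : ℕ => n - i) ?_ ?_).symm
  · intro i j hij
    simp at hij
    exact hij
  · intro k hk
    have : k ≤ n := by
      by_contra hc
      exact hk (hh k (not_le.1 hc))
    exact ⟨(n - k).toNat, by simp; omega⟩

theorem tsum_int_ge_eq {h : ℤ → ℝ≥0∞} (n : ℤ) (hh : ∀ k, k < n → h k = 0) :
    ∑' k, h k = ∑' i : ℕ, h (n + i) := by
  refine (Function.Injective.tsum_eq (g := fun i : ℕ => n + i) ?_ ?_).symm
  · intro i j hij
    simp at hij
    exact hij
  · intro k hk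
    have : n ≤ k := by
      by_contra hc
      exact hk (hh k (not_le.1 hc))
    exact ⟨(k - n).toNat, by simp; omega⟩

theorem tsum_two_rpow_lt_le {α : ℝ} (hα : 0 < α) : ∃ C : ℝ≥0∞, C ≠ ∞ ∧ ∀ t : ℝ≥0∞,
    ∑' k : ℤ, (if (2 : ℝ≥0∞) ^ (k : ℝ) < t then (2 : ℝ≥0∞) ^ (k * α) else 0) ≤ C * t ^ α := by
  refine ⟨1 + ∑' i : ℕ, (2 : ℝ≥0∞) ^ (-(i * α)), by
    simpa using tsum_two_rpow_neg_ne_top hα, fun t => ?_⟩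
  rcases eq_or_ne t 0 with rfl | h0
  · simp
  rcases eq_or_ne t ∞ with rfl | htop
  · rw [ENNReal.top_rpow_of_pos hα, ENNReal.mul_top]
    · exact le_top
    · exact (lt_of_lt_of_le one_pos le_self_add).ne'
  obtain ⟨n, hn1, hn2⟩ := ENNReal.exists_mem_Ioc_zpow h0 htop ENNReal.one_lt_two
    ENNReal.ofNat_ne_top
  rw [← ENNReal.rpow_intCast] at hn1 hn2
  rw [tsum_int_le_eq n]
  · calc _ ≤ ∑' i : ℕ, (2 : ℝ≥0∞) ^ (-(i * α)) * t ^ α := by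
          refine ENNReal.tsum_le_tsum fun i => ?_
          split_ifs
          · have : (2 : ℝ≥0∞) ^ (((n - i : ℤ) : ℝ) * α)
                = 2 ^ (-(i * α)) * (2 ^ (n : ℝ)) ^ α := by
              rw [← ENNReal.rpow_mul, ← two_rpow_add]; congr 1; push_cast; ring
            rw [this]
            gcongr
          · exact zero_le
      _ = (∑' i : ℕ, (2 : ℝ≥0∞) ^ (-(i * α))) * t ^ α := ENNReal.tsum_mul_right
      _ ≤ _ := by gcongr; exact le_add_self
  · intro k hk
    rw [if_neg]
    rw [not_lt]
    refine hn2.trans (two_rpow_mono ?_)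
    exact_mod_cast hk

theorem rpow_le_tsum_two_rpow {m : ℝ} (hm : 0 < m) (c : ℝ≥0∞) (hc0 : c ≠ 0) (hc : c ≠ ∞)
    (t : ℝ≥0∞) :
    t ^ m ≤ ∑' k : ℤ, (if c * (2 : ℝ≥0∞) ^ (k : ℝ) < t then (2 * c) ^ m * (2 : ℝ≥0∞) ^ (k * m)
      else 0) := by
  rcases eq_or_ne t 0 with rfl | h0
  · simp [hm]
  rcases eq_or_ne t ∞ with rfl | htop
  · have h1 : ∀ k : ℤ, (c * (2 : ℝ≥0∞) ^ (k : ℝ) < ∞) := fun k =>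
      (ENNReal.mul_lt_top hc.lt_top (two_rpow_ne_top _).lt_top)
    simp only [h1, if_true]
    have h2 : (2 * c) ^ m ≠ 0 := by
      simp [ENNReal.rpow_eq_zero_iff, hc0, hc, ENNReal.mul_eq_top]
    have h3 : ∑' i : ℕ, (2 * c) ^ m = ∞ := ENNReal.tsum_const_eq_top_of_ne_zero h2
    refine le_top.trans (h3.symm.le.trans ?_)
    refine le_trans (ENNReal.tsum_le_tsum fun i => ?_)
      (ENNReal.tsum_comp_le_tsum_of_injective (Nat.cast_injective (R := ℤ)) _)
    refine le_mul_of_one_le_right zero_le ?_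
    rw [← ENNReal.rpow_zero (x := 2)]
    exact two_rpow_mono (by positivity)
  obtain ⟨n, hn1, hn2⟩ := ENNReal.exists_mem_Ioc_zpow (x := t / c)
    (by simp [h0, hc]) (ENNReal.div_ne_top htop hc0) ENNReal.one_lt_two ENNReal.ofNat_ne_top
  rw [← ENNReal.rpow_intCast] at hn1 hn2
  rw [ENNReal.lt_div_iff_mul_lt (.inl hc0) (.inl hc), mul_comm] at hn1
  rw [ENNReal.div_le_iff hc0 hc] at hn2
  refine le_trans ?_ (ENNReal.le_tsum n)
  rw [if_pos hn1, ENNReal.rpow_mul, ← ENNReal.mul_rpow_of_nonneg _ _ hm.le]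
  refine ENNReal.rpow_le_rpow (hn2.trans (le_of_eq ?_)) hm.le
  push_cast
  rw [two_rpow_add, ENNReal.rpow_one]
  ring

theorem tsum_min_two_rpow_le {α : ℝ} (hα : 0 < α) : ∃ C : ℝ≥0∞, C ≠ ∞ ∧ ∀ a b : ℝ≥0∞,
    ∑' k : ℤ, min ((2 : ℝ≥0∞) ^ (-(k * α)) * a) ((2 : ℝ≥0∞) ^ (k * α) * b)
      ≤ C * (a * b) ^ (1 / 2 : ℝ) := by
  set S := ∑' i : ℕ, (2 : ℝ≥0∞) ^ (-(i * α)) with hS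
  have hSt : S ≠ ∞ := tsum_two_rpow_neg_ne_top hα
  have hS1 : 1 ≤ S := by
    refine le_trans (le_of_eq ?_) (ENNReal.le_tsum 0)
    simp
  refine ⟨2 ^ α * (S + S), ENNReal.mul_ne_top (two_rpow_ne_top _) (by simp [hSt]),
    fun a b => ?_⟩
  rcases eq_or_ne a 0 with rfl | ha0
  · simp
  rcases eq_or_ne b 0 with rfl | hb0
  · simp
  have hC : 2 ^ α * (S + S) ≠ 0 := by
    refine mul_ne_zero (two_rpow_ne_zero _) ?_
    exact (lt_of_lt_of_le one_pos (hS1.trans le_self_add)).ne'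
  rcases eq_or_ne (a * b) ∞ with htop | htop
  · rw [htop, ENNReal.top_rpow_of_pos (by norm_num), ENNReal.mul_top hC]; exact le_top
  have ha : a ≠ ∞ := fun h => htop (by rw [h, ENNReal.top_mul hb0])
  have hb : b ≠ ∞ := fun h => htop (by rw [h, ENNReal.mul_top ha0])
  set g := (a * b) ^ (1 / 2 : ℝ) with hg
  have hgg : g * g = a * b := by
    rw [hg, ← ENNReal.rpow_add_of_nonneg _ _ (by norm_num) (by norm_num)]; norm_num
  have hg0 : g ≠ 0 := fun h => by
    rw [h, zero_mul] at hgg; exact mul_ne_zero ha0 hb0 hgg.symm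
  have hgt : g ≠ ∞ := fun h => by
    rw [h, ENNReal.top_mul_top] at hgg; exact htop hgg.symm
  obtain ⟨n, hn1, hn2⟩ := ENNReal.exists_mem_Ioc_zpow (x := a / g) (y := 2 ^ α)
    (by simp [ha0, hgt]) (ENNReal.div_ne_top ha hg0)
    (ENNReal.one_lt_rpow ENNReal.one_lt_two hα) (two_rpow_ne_top _)
  rw [← ENNReal.rpow_intCast, ← ENNReal.rpow_mul] at hn1 hn2
  rw [ENNReal.div_le_iff hg0 hgt] at hn2
  rw [ENNReal.lt_div_iff_mul_lt (.inl hg0) (.inl hgt)] at hn1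
  have hb' : 2 ^ (α * n) * b ≤ g := by
    have : 2 ^ (α * n) * b * g ≤ g * g := by
      rw [hgg, mul_right_comm]; gcongr
    rwa [ENNReal.mul_le_mul_iff_left hg0 hgt] at this
  have key : ∀ k : ℤ, min ((2 : ℝ≥0∞) ^ (-(k * α)) * a) ((2 : ℝ≥0∞) ^ (k * α) * b) ≤
      (if k ≤ n then 2 ^ ((k - n : ℝ) * α) * g else 0)
      + (if n ≤ k then 2 ^ ((n - k : ℝ) * α) * (2 ^ α * g) else 0) := by
    intro k
    rcases le_total k n with hk | hk
    · refine (min_le_right _ _).trans (le_trans ?_ le_self_add)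
      rw [if_pos hk]
      calc (2 : ℝ≥0∞) ^ (k * α) * b = 2 ^ ((k - n : ℝ) * α) * (2 ^ (α * n) * b) := by
            rw [← mul_assoc, ← two_rpow_add]; congr 2; ring
        _ ≤ _ := by gcongr
    · refine (min_le_left _ _).trans (le_trans ?_ le_add_self)
      rw [if_pos hk]
      calc (2 : ℝ≥0∞) ^ (-(k * α)) * a ≤ 2 ^ (-(k * α)) * (2 ^ (α * ↑(n + 1)) * g) := by gcongr
        _ = _ := by
            rw [← mul_assoc, ← mul_assoc, ← two_rpow_add, ← two_rpow_add]
            congr 2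
            push_cast; ring
  refine (ENNReal.tsum_le_tsum key).trans ?_
  rw [ENNReal.tsum_add, tsum_int_le_eq n (fun k hk => if_neg (not_le.2 hk)),
    tsum_int_ge_eq n (fun k hk => if_neg (not_le.2 hk))]
  have e1 : ∀ i : ℕ, (if (n - i : ℤ) ≤ n then (2 : ℝ≥0∞) ^ ((((n - i : ℤ) : ℝ) - n) * α) * g
      else 0) = 2 ^ (-(i * α)) * g := fun i => by
    rw [if_pos (by omega)]; congr 2; push_cast; ring
  have e2 : ∀ i : ℕ, (if n ≤ (n + i : ℤ) then
      (2 : ℝ≥0∞) ^ (((n : ℝ) - ((n + i : ℤ) : ℝ)) * α) * (2 ^ α * g)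
      else 0) = 2 ^ (-(i * α)) * (2 ^ α * g) := fun i => by
    rw [if_pos (by omega)]; congr 2; push_cast; ring
  simp_rw [e1, e2, ENNReal.tsum_mul_right, ← hS]
  have h1 : (1 : ℝ≥0∞) ≤ 2 ^ α := by
    rw [← ENNReal.rpow_zero (x := 2)]; exact two_rpow_mono hα.le
  calc S * g + S * (2 ^ α * g) ≤ S * (2 ^ α * g) + S * (2 ^ α * g) := by
        gcongr; exact le_mul_of_one_le_left zero_le h1
    _ = _ := by ring

end Geometric

section Maximal

variable {E : Type*} [NormedAddCommGroup E] [InnerProductSpace ℝ E] [FiniteDimensional ℝ E]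
  [MeasurableSpace E] [BorelSpace E]

/-- The weight `(1 + ‖z‖)^{-(d+1)}`, `d` being the dimension. -/
noncomputable def decayWeight (z : E) : ℝ := ((1 + ‖z‖) ^ (Module.finrank ℝ E + 1))⁻¹

/-- The maximal function built from the dyadic dilates of `decayWeight`. -/
noncomputable def dyadicMax (f : E → ℝ≥0∞) (x : E) : ℝ≥0∞ :=
  ⨆ j : ℤ, ∫⁻ z, ENNReal.ofReal (decayWeight z) * f (x - (2 : ℝ) ^ (-(j : ℝ)) • z)

theorem decayWeight_pos (z : E) : 0 < decayWeight z := by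
  unfold decayWeight; positivity

theorem continuous_decayWeight : Continuous (decayWeight : E → ℝ) := by
  unfold decayWeight
  exact Continuous.inv₀ (by fun_prop) (fun z => by positivity)

theorem integrable_decayWeight : Integrable (decayWeight : E → ℝ) := by
  have := integrable_one_add_norm (E := E) (μ := volume)
    (r := (Module.finrank ℝ E + 1 : ℕ)) (by push_cast; linarith)
  refine this.congr (ae_of_all _ fun z => ?_)
  simp only [decayWeight]
  rw [Real.rpow_neg (by positivity), Real.rpow_natCast]

theorem lintegral_decayWeight_ne_top :
    ∫⁻ z : E, ENNReal.ofReal (decayWeight z) ≠ ∞ :=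
  (integrable_decayWeight.lintegral_lt_top).ne

theorem measurable_dyadicMax {f : E → ℝ≥0∞} (hf : Measurable f) : Measurable (dyadicMax f) := by
  refine Measurable.iSup fun j => ?_
  refine Measurable.lintegral_prod_right' (f := fun p : E × E =>
    ENNReal.ofReal (decayWeight p.2) * f (p.1 - (2 : ℝ) ^ (-(j : ℝ)) • p.2)) ?_
  have := (continuous_decayWeight (E := E)).measurable
  fun_prop

theorem dyadicMax_mono {f g : E → ℝ≥0∞} (h : ∀ x, f x ≤ g x) (x : E) :
    dyadicMax f x ≤ dyadicMax g x :=
  iSup_mono fun _ => lintegral_mono fun _ => by gcongr; exact h _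

theorem dyadicMax_const_mul (c : ℝ≥0∞) (hc : c ≠ ∞) (f : E → ℝ≥0∞) (x : E) :
    dyadicMax (fun y => c * f y) x = c * dyadicMax f x := by
  simp only [dyadicMax, ENNReal.mul_iSup]
  refine iSup_congr fun j => ?_
  rw [← lintegral_const_mul' _ _ hc]
  congr 1; ext z; ring

theorem lintegral_decayWeight_le_dyadicMax (f : E → ℝ≥0∞) (j : ℤ) (x : E) :
    ∫⁻ z, ENNReal.ofReal (decayWeight z) * f (x - (2 : ℝ) ^ (-(j : ℝ)) • z) ≤ dyadicMax f x :=
  le_iSup (fun j : ℤ =>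
    ∫⁻ z, ENNReal.ofReal (decayWeight z) * f (x - (2 : ℝ) ^ (-(j : ℝ)) • z)) j

/-- The set where some ball average of `f` exceeds `l`. -/
def largeAverageSet (f : E → ℝ≥0∞) (l : ℝ≥0∞) : Set E :=
  {x | ∃ ρ : ℝ, 0 < ρ ∧ l * volume (Metric.ball x ρ) < ∫⁻ y in Metric.ball x ρ, f y}

theorem volume_largeAverageSet_le (f : E → ℝ≥0∞) (l : ℝ≥0∞) :
    l * volume (largeAverageSet f l) ≤ ENNReal.ofReal (4 ^ Module.finrank ℝ E) * ∫⁻ y, f y := by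
  set S : ℕ → Set E := fun n =>
    {x | ∃ ρ : ℝ, 0 < ρ ∧ ρ ≤ n ∧ l * volume (Metric.ball x ρ) < ∫⁻ y in Metric.ball x ρ, f y}
    with hS
  have hU : largeAverageSet f l = ⋃ n, S n := by
    ext x
    simp only [largeAverageSet, hS, Set.mem_ofPred_eq, Set.mem_iUnion]
    constructor
    · rintro ⟨ρ, h1, h2⟩
      obtain ⟨n, hn⟩ := exists_nat_ge ρ
      exact ⟨n, ρ, h1, hn, h2⟩
    · rintro ⟨n, ρ, h1, -, h2⟩
      exact ⟨ρ, h1, h2⟩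
  have hmono : Monotone S := by
    intro n m hnm x
    rintro ⟨ρ, h1, h2, h3⟩
    exact ⟨ρ, h1, h2.trans (by exact_mod_cast hnm), h3⟩
  rw [hU, hmono.measure_iUnion, ENNReal.mul_iSup]
  refine iSup_le fun n => ?_
  have hch : ∀ x : E, ∃ ρ : ℝ, x ∈ S n → 0 < ρ ∧ ρ ≤ n ∧
      l * volume (Metric.ball x ρ) < ∫⁻ y in Metric.ball x ρ, f y := by
    intro x
    by_cases hx : x ∈ S n
    · obtain ⟨ρ, h⟩ := hx
      exact ⟨ρ, fun _ => h⟩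
    · exact ⟨0, fun h => absurd h hx⟩
  choose ρ hρ using hch
  obtain ⟨u, hut, hdisj, hcov⟩ := Vitali.exists_disjoint_subfamily_covering_enlargement_ball
    (S n) (fun x : E => x) ρ n (fun a ha => (hρ a ha).2.1) 4 (by norm_num)
  have hc : u.Countable := hdisj.countable_of_isOpen (fun _ _ => Metric.isOpen_ball)
    (fun i hi => Metric.nonempty_ball.2 (hρ i (hut hi)).1)
  have hsub : S n ⊆ ⋃ b ∈ u, Metric.ball b (4 * ρ b) := by
    intro x hx
    obtain ⟨b, hb, hsb⟩ := hcov x hx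
    exact Set.mem_iUnion₂.2 ⟨b, hb, hsb (Metric.mem_ball_self (hρ x hx).1)⟩
  calc l * volume (S n) ≤ l * ∑' b : u, volume (Metric.ball (b : E) (4 * ρ b)) := by
        gcongr
        exact (measure_mono hsub).trans (measure_biUnion_le volume hc _)
    _ = ∑' b : u, ENNReal.ofReal (4 ^ Module.finrank ℝ E) *
          (l * volume (Metric.ball (b : E) (ρ b))) := by
        rw [← ENNReal.tsum_mul_left]
        congr 1; ext b
        rw [Measure.addHaar_ball_mul_of_pos _ _ (by norm_num), Measure.addHaar_ball_center _ (b : E)]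
        ring
    _ ≤ ∑' b : u, ENNReal.ofReal (4 ^ Module.finrank ℝ E) *
          ∫⁻ y in Metric.ball (b : E) (ρ b), f y := by
        refine ENNReal.tsum_le_tsum fun b => ?_
        gcongr
        exact (hρ b (hut b.2)).2.2.le
    _ = ENNReal.ofReal (4 ^ Module.finrank ℝ E) * ∫⁻ y in ⋃ b ∈ u, Metric.ball b (ρ b), f y := by
        rw [ENNReal.tsum_mul_left, lintegral_biUnion hc (fun _ _ => measurableSet_ball) hdisj]
    _ ≤ _ := by gcongr; exact Measure.restrict_le_self

theorem setLIntegral_ball_comp_sub_smul (f : E → ℝ≥0∞) (x : E) {t : ℝ} (ht : 0 < t) (ρ : ℝ) :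
    ∫⁻ z in Metric.ball 0 ρ, f (x - t • z)
      = ENNReal.ofReal ((t ^ Module.finrank ℝ E)⁻¹) * ∫⁻ y in Metric.ball x (t * ρ), f y := by
  have h1 : ∀ g : E → ℝ≥0∞, ∫⁻ z, g (t • z)
      = ENNReal.ofReal ((t ^ Module.finrank ℝ E)⁻¹) * ∫⁻ y, g y := by
    intro g
    have he := (Homeomorph.smulOfNeZero t ht.ne' : E ≃ₜ E).measurableEmbedding
    have := he.lintegral_map (μ := volume) g
    change ∫⁻ y, g y ∂(Measure.map (fun z => t • z) volume) = ∫⁻ z, g (t • z) at this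
    rw [← this, Measure.map_addHaar_smul _ ht.ne', lintegral_smul_measure,
      abs_of_pos (by positivity), smul_eq_mul]
  have h2 := h1 (fun w => (Metric.ball x (t * ρ)).indicator f (x - w))
  rw [lintegral_sub_left_eq_self (fun w => (Metric.ball x (t * ρ)).indicator f w) x,
    lintegral_indicator measurableSet_ball] at h2
  rw [← h2, ← lintegral_indicator measurableSet_ball]
  congr 1; ext z
  have : z ∈ Metric.ball (0 : E) ρ ↔ x - t • z ∈ Metric.ball x (t * ρ) := by
    simp [Metric.mem_ball, dist_eq_norm, norm_smul, abs_of_pos ht, ht]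
  by_cases hz : z ∈ Metric.ball (0 : E) ρ
  · rw [Set.indicator_of_mem hz, Set.indicator_of_mem (this.1 hz)]
  · rw [Set.indicator_of_notMem hz, Set.indicator_of_notMem (fun h => hz (this.2 h))]

theorem decayWeight_le_tsum (z : E) : ENNReal.ofReal (decayWeight z) ≤
    ∑' i : ℕ, (2 : ℝ≥0∞) ^ ((Module.finrank ℝ E + 1) * (1 - i : ℝ)) *
      (Metric.ball (0 : E) (2 ^ (i : ℝ))).indicator 1 z := by
  obtain ⟨n, hn1, hn2⟩ := exists_nat_pow_near (x := 1 + ‖z‖) (y := 2) (by simp) one_lt_two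
  refine le_trans ?_ (ENNReal.le_tsum (n + 1))
  rw [Set.indicator_of_mem]
  · simp only [Pi.one_apply, mul_one]
    rw [← ofReal_two_rpow]
    refine ENNReal.ofReal_le_ofReal ?_
    rw [decayWeight, show ((Module.finrank ℝ E + 1 : ℝ) * (1 - ((n + 1 : ℕ) : ℝ)))
      = -((n * (Module.finrank ℝ E + 1) : ℕ) : ℝ) by push_cast; ring, Real.rpow_neg (by norm_num),
      Real.rpow_natCast, pow_mul]
    gcongr
  · rw [mem_ball_zero_iff, Real.rpow_natCast]
    linarith

theorem exists_dyadicMax_le_of_averages : ∃ K : ℝ≥0∞, K ≠ ∞ ∧ K ≠ 0 ∧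
    ∫⁻ z : E, ENNReal.ofReal (decayWeight z) ≤ K ∧
    ∀ (f : E → ℝ≥0∞) (_ : Measurable f) (l : ℝ≥0∞) (x : E), x ∉ largeAverageSet f l →
      dyadicMax f x ≤ K * l := by
  set d := Module.finrank ℝ E with hd
  set V := volume (Metric.ball (0 : E) 1)
  set K₀ : ℝ≥0∞ := (2 ^ (d + 1 : ℝ) * V) * ∑' i : ℕ, (2 : ℝ≥0∞) ^ (-(i * (1 : ℝ)))
  have hK₀ : K₀ ≠ ∞ := ENNReal.mul_ne_top (ENNReal.mul_ne_top (two_rpow_ne_top _)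
    measure_ball_lt_top.ne) (tsum_two_rpow_neg_ne_top one_pos)
  refine ⟨K₀ + 1 + ∫⁻ z : E, ENNReal.ofReal (decayWeight z), by
    simp [hK₀, lintegral_decayWeight_ne_top], by simp, le_add_self, ?_⟩
  intro f hf l x hx
  simp only [largeAverageSet, Set.mem_ofPred_eq, not_exists, not_and, not_lt] at hx
  refine (iSup_le fun j => ?_).trans (by
    gcongr; exact le_self_add.trans le_self_add : K₀ * l ≤ _)
  set t : ℝ := (2 : ℝ) ^ (-(j : ℝ)) with ht
  have htp : 0 < t := by positivity
  calc ∫⁻ z, ENNReal.ofReal (decayWeight z) * f (x - t • z)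
      ≤ ∫⁻ z, ∑' i : ℕ, (2 : ℝ≥0∞) ^ ((d + 1) * (1 - i : ℝ)) *
          (Metric.ball (0 : E) (2 ^ (i : ℝ))).indicator (fun z => f (x - t • z)) z := by
        refine lintegral_mono fun z => ?_
        refine (mul_le_mul_left (decayWeight_le_tsum z) _).trans ?_
        rw [← ENNReal.tsum_mul_right]
        refine ENNReal.tsum_le_tsum fun i => le_of_eq ?_
        rw [mul_assoc]
        congr 1
        by_cases hz : z ∈ Metric.ball (0 : E) (2 ^ (i : ℝ))
        · rw [Set.indicator_of_mem hz, Set.indicator_of_mem hz, Pi.one_apply, one_mul]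
        · rw [Set.indicator_of_notMem hz, Set.indicator_of_notMem hz, zero_mul]
    _ = ∑' i : ℕ, (2 : ℝ≥0∞) ^ ((d + 1) * (1 - i : ℝ)) *
          (ENNReal.ofReal ((t ^ d)⁻¹) * ∫⁻ y in Metric.ball x (t * 2 ^ (i : ℝ)), f y) := by
        have hm : Measurable fun z => f (x - t • z) := by fun_prop
        rw [lintegral_tsum fun i =>
          ((hm.indicator measurableSet_ball).const_mul _).aemeasurable]
        congr 1; ext i
        rw [lintegral_const_mul _ (hm.indicator measurableSet_ball),
          lintegral_indicator measurableSet_ball, setLIntegral_ball_comp_sub_smul f x htp]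
    _ ≤ ∑' i : ℕ, (2 ^ (d + 1 : ℝ) * V) * (2 : ℝ≥0∞) ^ (-(i * (1 : ℝ))) * l := by
        refine ENNReal.tsum_le_tsum fun i => ?_
        have h1 := hx (t * 2 ^ (i : ℝ)) (by positivity)
        have h2 : volume (Metric.ball x (t * 2 ^ (i : ℝ)))
            = ENNReal.ofReal (t ^ d) * (2 ^ (i * d : ℝ) * V) := by
          have := Measure.addHaar_ball_mul_of_pos (volume : Measure E) x
            (r := t * 2 ^ (i : ℝ)) (by positivity) 1
          rw [mul_one] at this
          rw [this, mul_pow, ENNReal.ofReal_mul (by positivity),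
            ← Real.rpow_mul_natCast two_pos.le (i : ℝ), ofReal_two_rpow, mul_assoc]
        rw [h2] at h1
        calc _ ≤ (2 : ℝ≥0∞) ^ ((d + 1) * (1 - i : ℝ)) * (ENNReal.ofReal ((t ^ d)⁻¹) *
              (l * (ENNReal.ofReal (t ^ d) * (2 ^ (i * d : ℝ) * V)))) := by gcongr
          _ = (2 : ℝ≥0∞) ^ ((d + 1) * (1 - i : ℝ)) * 2 ^ (i * d : ℝ) * V * l *
              (ENNReal.ofReal ((t ^ d)⁻¹) * ENNReal.ofReal (t ^ d)) := by ring
          _ = _ := by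
            rw [← ENNReal.ofReal_mul (by positivity), inv_mul_cancel₀ (by positivity),
              ← two_rpow_add, mul_right_comm ((2 : ℝ≥0∞) ^ (d + 1 : ℝ)) V, ← two_rpow_add,
              ENNReal.ofReal_one, mul_one]
            congr 3; ring
    _ = K₀ * l := by
        rw [ENNReal.tsum_mul_right, ENNReal.tsum_mul_left]

theorem dyadicMax_add_const_le (f g : E → ℝ≥0∞) (hg : Measurable g) (l : ℝ≥0∞)
    (h : ∀ x, f x ≤ g x + l) (x : E) :
    dyadicMax f x ≤ dyadicMax g x + l * ∫⁻ z : E, ENNReal.ofReal (decayWeight z) := by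
  refine iSup_le fun j => ?_
  have hw := (continuous_decayWeight (E := E)).measurable
  calc _ ≤ ∫⁻ z, (ENNReal.ofReal (decayWeight z) * g (x - (2 : ℝ) ^ (-(j : ℝ)) • z)
        + l * ENNReal.ofReal (decayWeight z)) := by
        refine lintegral_mono fun z => ?_
        refine (mul_le_mul_right (h _) _).trans (le_of_eq ?_)
        ring
    _ = _ := by
        rw [lintegral_add_left (by fun_prop), lintegral_const_mul _ (by fun_prop)]
    _ ≤ _ := by gcongr; exact lintegral_decayWeight_le_dyadicMax g j x

/-- The strong-type maximal inequality. -/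
theorem exists_lintegral_dyadicMax_rpow_le {m : ℝ} (hm : 1 < m) : ∃ C : ℝ≥0∞, C ≠ ∞ ∧
    ∀ f : E → ℝ≥0∞, Measurable f → ∫⁻ x, dyadicMax f x ^ m ≤ C * ∫⁻ x, f x ^ m := by
  obtain ⟨K, hKt, hK0, hKw, hK⟩ := exists_dyadicMax_le_of_averages (E := E)
  obtain ⟨G, hGt, hG⟩ := tsum_two_rpow_lt_le (α := m - 1) (by linarith)
  set D : ℝ≥0∞ := ENNReal.ofReal (4 ^ Module.finrank ℝ E) with hD
  set c : ℝ≥0∞ := 2 * K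
  have hc0 : c ≠ 0 := by simp [c, hK0]
  have hct : c ≠ ∞ := ENNReal.mul_ne_top (by simp) hKt
  have hm0 : 0 < m := by linarith
  refine ⟨(2 * c) ^ m * D * G, ?_, fun f hf => ?_⟩
  · refine ENNReal.mul_ne_top (ENNReal.mul_ne_top ?_ ENNReal.ofReal_ne_top) hGt
    exact ENNReal.rpow_ne_top_of_nonneg hm0.le (ENNReal.mul_ne_top (by simp) hct)
  have hM := measurable_dyadicMax hf
  have weak : ∀ k : ℤ, (2 : ℝ≥0∞) ^ (k : ℝ) *
      volume {x | c * (2 : ℝ≥0∞) ^ (k : ℝ) < dyadicMax f x}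
      ≤ D * ∫⁻ x in {x | (2 : ℝ≥0∞) ^ (k : ℝ) < f x}, f x := by
    intro k
    set l : ℝ≥0∞ := (2 : ℝ≥0∞) ^ (k : ℝ)
    have hs : MeasurableSet {x | l < f x} := measurableSet_lt measurable_const hf
    set g := {x | l < f x}.indicator f with hg
    have hgm : Measurable g := hf.indicator hs
    rw [← lintegral_indicator hs, ← hg]
    refine le_trans ?_ (volume_largeAverageSet_le g l)
    gcongr
    intro x hx
    by_contra hxn
    have h1 := hK g hgm l x hxn
    have h2 := dyadicMax_add_const_le f g hgm l (fun y => by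
      by_cases hy : l < f y
      · rw [hg, Set.indicator_of_mem (by exact hy)]; exact le_self_add
      · exact (not_lt.1 hy).trans le_add_self) x
    refine absurd hx (not_lt.2 (h2.trans ?_))
    calc _ ≤ K * l + l * K := by gcongr
      _ = _ := by ring
  calc ∫⁻ x, dyadicMax f x ^ m
      ≤ ∫⁻ x, ∑' k : ℤ, (if c * (2 : ℝ≥0∞) ^ (k : ℝ) < dyadicMax f x then
          (2 * c) ^ m * (2 : ℝ≥0∞) ^ (k * m) else 0) :=
        lintegral_mono fun x => rpow_le_tsum_two_rpow hm0 c hc0 hct _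
    _ = ∑' k : ℤ, (2 * c) ^ m * (2 : ℝ≥0∞) ^ (k * m) *
          volume {x | c * (2 : ℝ≥0∞) ^ (k : ℝ) < dyadicMax f x} := by
        rw [lintegral_tsum fun k => (Measurable.ite (measurableSet_lt measurable_const hM)
          measurable_const measurable_const).aemeasurable]
        congr 1; ext k
        rw [← lintegral_indicator_const (measurableSet_lt measurable_const hM)]
        simp only [Set.indicator_apply, Set.mem_ofPred_eq]
    _ ≤ ∑' k : ℤ, (2 * c) ^ m * D * ∫⁻ x, (if (2 : ℝ≥0∞) ^ (k : ℝ) < f x then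
          (2 : ℝ≥0∞) ^ (k * (m - 1)) else 0) * f x := by
        refine ENNReal.tsum_le_tsum fun k => ?_
        have : (2 : ℝ≥0∞) ^ (k * m) = 2 ^ (k * (m - 1)) * 2 ^ (k : ℝ) := by
          rw [← two_rpow_add]; congr 1; ring
        rw [this]
        calc _ = (2 * c) ^ m * 2 ^ (k * (m - 1)) * (2 ^ (k : ℝ) *
              volume {x | c * (2 : ℝ≥0∞) ^ (k : ℝ) < dyadicMax f x}) := by ring
          _ ≤ (2 * c) ^ m * 2 ^ (k * (m - 1)) *
              (D * ∫⁻ x in {x | (2 : ℝ≥0∞) ^ (k : ℝ) < f x}, f x) := mul_le_mul' le_rfl (weak k)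
          _ = (2 * c) ^ m * D * (2 ^ (k * (m - 1)) *
              ∫⁻ x in {x | (2 : ℝ≥0∞) ^ (k : ℝ) < f x}, f x) := by ring
          _ = _ := by
            have hs : MeasurableSet {x | (2 : ℝ≥0∞) ^ (k : ℝ) < f x} :=
              measurableSet_lt measurable_const hf
            rw [← lintegral_const_mul _ hf, ← lintegral_indicator hs]
            simp only [Set.indicator_apply, Set.mem_ofPred_eq, ite_mul, zero_mul]
    _ = (2 * c) ^ m * D * ∫⁻ x, (∑' k : ℤ, (if (2 : ℝ≥0∞) ^ (k : ℝ) < f x then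
          (2 : ℝ≥0∞) ^ (k * (m - 1)) else 0)) * f x := by
        simp_rw [← ENNReal.tsum_mul_right]
        rw [ENNReal.tsum_mul_left, lintegral_tsum]
        intro k
        exact ((Measurable.ite (measurableSet_lt measurable_const hf)
          measurable_const measurable_const).mul hf).aemeasurable
    _ ≤ (2 * c) ^ m * D * ∫⁻ x, G * f x ^ m := by
        refine mul_le_mul' le_rfl (lintegral_mono fun x => ?_)
        calc _ ≤ G * f x ^ (m - 1) * f x := by gcongr; exact hG _
          _ = G * (f x ^ (m - 1) * f x ^ (1 : ℝ)) := by rw [ENNReal.rpow_one, mul_assoc]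
          _ = G * f x ^ m := by
            rw [← ENNReal.rpow_add_of_nonneg _ _ (by linarith) (by norm_num)]; congr 2; ring
    _ = _ := by
        rw [lintegral_const_mul _ (by fun_prop)]; ring

end Maximal

section ReciprocalExponent

variable {E : Type*} [NormedAddCommGroup E] [InnerProductSpace ℝ E] [FiniteDimensional ℝ E]
  [MeasurableSpace E] [BorelSpace E]

/-- The `L^{1/a}` norm of a nonnegative function, with `L^∞` at `a = 0`. -/
noncomputable def recipNorm (a : ℝ) (f : E → ℝ≥0∞) : ℝ≥0∞ :=
  if a = 0 then essSup f volume else (∫⁻ x, f x ^ (1 / a)) ^ a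

theorem recipNorm_of_pos {a : ℝ} (ha : 0 < a) (f : E → ℝ≥0∞) :
    recipNorm a f = (∫⁻ x, f x ^ (1 / a)) ^ a := if_neg ha.ne'

theorem eLpNorm_eq_recipNorm {F : Type*} [NormedAddCommGroup F] (p : ℝ≥0∞) (hp : p ≠ 0)
    (f : E → F) : eLpNorm f p volume = recipNorm (p⁻¹).toReal (fun x => ‖f x‖ₑ) := by
  by_cases hpt : p = ∞
  · simp [hpt, recipNorm, eLpNormEssSup]
  · have : 0 < p.toReal := ENNReal.toReal_pos hp hpt
    rw [eLpNorm_eq_lintegral_rpow_enorm_toReal hp hpt, ENNReal.toReal_inv,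
      recipNorm_of_pos (by positivity)]
    simp

theorem recipNorm_mono {a : ℝ} (ha : 0 ≤ a) {f g : E → ℝ≥0∞} (h : ∀ x, f x ≤ g x) :
    recipNorm a f ≤ recipNorm a g := by
  unfold recipNorm
  split_ifs
  · exact essSup_mono_ae (ae_of_all _ h)
  · gcongr; exact h _

theorem recipNorm_const_mul {a : ℝ} (ha : 0 < a) (c : ℝ≥0∞) (hc : c ≠ ∞) (f : E → ℝ≥0∞) :
    recipNorm a (fun x => c * f x) = c * recipNorm a f := by
  rw [recipNorm_of_pos ha, recipNorm_of_pos ha]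
  simp_rw [ENNReal.mul_rpow_of_nonneg _ _ (by positivity : (0 : ℝ) ≤ 1 / a)]
  rw [lintegral_const_mul' _ _ (ENNReal.rpow_ne_top_of_nonneg (by positivity) hc),
    ENNReal.mul_rpow_of_nonneg _ _ ha.le, ← ENNReal.rpow_mul, one_div_mul_cancel ha.ne',
    ENNReal.rpow_one]

theorem recipNorm_add_le {a : ℝ} (ha : 0 < a) (ha1 : a ≤ 1) {f g : E → ℝ≥0∞} (hf : Measurable f)
    (hg : Measurable g) :
    recipNorm a (fun x => f x + g x) ≤ recipNorm a f + recipNorm a g := by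
  have := ENNReal.lintegral_Lp_add_le (μ := volume) hf.aemeasurable hg.aemeasurable
    (p := 1 / a) (by rw [le_div_iff₀ ha]; linarith)
  simpa [recipNorm_of_pos ha] using this

/-- Hölder's inequality with powers. -/
theorem recipNorm_rpow_mul_rpow_le {a b x y : ℝ} (ha : 0 ≤ a) (hb : 0 < b) (hx : 0 ≤ x)
    (hy : 0 < y) {f g : E → ℝ≥0∞} (hf : Measurable f) (hg : Measurable g) :
    recipNorm (x * a + y * b) (fun z => f z ^ x * g z ^ y)
      ≤ recipNorm a f ^ x * recipNorm b g ^ y := by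
  have hyb : 0 < y * b := by positivity
  have ht : 0 < x * a + y * b := by positivity
  rcases ha.eq_or_lt with rfl | ha
  · simp only [mul_zero, zero_add]
    rw [recipNorm_of_pos hyb, recipNorm_of_pos hb]
    simp only [recipNorm, if_true]
    have e : ∀ S : ℝ≥0∞, S ^ x * (∫⁻ z, g z ^ (1 / b)) ^ (b * y)
        = (S ^ (x * (1 / (y * b))) * ∫⁻ z, g z ^ (1 / b)) ^ (y * b) := by
      intro S
      rw [ENNReal.mul_rpow_of_nonneg _ _ hyb.le, ← ENNReal.rpow_mul]
      congr 2 <;> field_simp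
    rw [← ENNReal.rpow_mul, e]
    refine ENNReal.rpow_le_rpow ?_ hyb.le
    rw [← lintegral_const_mul _ (by fun_prop)]
    refine lintegral_mono_ae ?_
    filter_upwards [ENNReal.ae_le_essSup (μ := volume) f] with z hz
    rw [ENNReal.mul_rpow_of_nonneg _ _ (by positivity), ← ENNReal.rpow_mul, ← ENNReal.rpow_mul]
    refine mul_le_mul' (ENNReal.rpow_le_rpow hz (by positivity)) (le_of_eq ?_)
    congr 1; field_simp
  · rw [recipNorm_of_pos ht, recipNorm_of_pos ha, recipNorm_of_pos hb]
    set t := x * a + y * b with htd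
    have key := ENNReal.lintegral_mul_norm_pow_le (μ := volume)
      (f := fun z => f z ^ (1 / a)) (g := fun z => g z ^ (1 / b))
      (by fun_prop) (by fun_prop) (p := x * a / t) (q := y * b / t)
      (by positivity) (by positivity) (by rw [← add_div, div_self ht.ne'])
    calc _ = (∫⁻ z, (f z ^ (1 / a)) ^ (x * a / t) * (g z ^ (1 / b)) ^ (y * b / t)) ^ t := by
          congr 2; ext z
          rw [ENNReal.mul_rpow_of_nonneg _ _ (by positivity), ← ENNReal.rpow_mul,
            ← ENNReal.rpow_mul, ← ENNReal.rpow_mul, ← ENNReal.rpow_mul]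
          congr 2 <;> field_simp
      _ ≤ _ := ENNReal.rpow_le_rpow key ht.le
      _ = _ := by
          rw [ENNReal.mul_rpow_of_nonneg _ _ ht.le, ← ENNReal.rpow_mul, ← ENNReal.rpow_mul,
            ← ENNReal.rpow_mul, ← ENNReal.rpow_mul]
          congr 2 <;> field_simp

theorem recipNorm_mul_le {a b : ℝ} (ha : 0 ≤ a) (hb : 0 < b) {f g : E → ℝ≥0∞}
    (hf : Measurable f) (hg : Measurable g) :
    recipNorm (a + b) (fun z => f z * g z) ≤ recipNorm a f * recipNorm b g := by
  simpa using recipNorm_rpow_mul_rpow_le ha hb zero_le_one one_pos hf hg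

theorem exists_recipNorm_dyadicMax_le {a : ℝ} (ha : 0 ≤ a) (ha1 : a < 1) :
    ∃ C : ℝ≥0∞, C ≠ ∞ ∧ ∀ f : E → ℝ≥0∞, Measurable f →
      recipNorm a (dyadicMax f) ≤ C * recipNorm a f := by
  rcases ha.eq_or_lt with rfl | ha
  · refine ⟨∫⁻ z : E, ENNReal.ofReal (decayWeight z), lintegral_decayWeight_ne_top,
      fun f hf => ?_⟩
    simp only [recipNorm, if_true]
    refine essSup_le_of_ae_le _ (ae_of_all _ fun x => iSup_le fun j => ?_)
    have hmp : Measure.QuasiMeasurePreserving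
        (fun z : E => x - (2 : ℝ) ^ (-(j : ℝ)) • z) volume volume := by
      have h1 : Measure.QuasiMeasurePreserving (fun z : E => (2 : ℝ) ^ (-(j : ℝ)) • z)
          volume volume := by
        refine ⟨by fun_prop, ?_⟩
        rw [Measure.map_addHaar_smul _ (by positivity)]
        exact Measure.smul_absolutelyContinuous
      exact (Measure.measurePreserving_sub_left volume x).quasiMeasurePreserving.comp h1
    rw [← lintegral_mul_const _ (by have := (continuous_decayWeight (E := E)).measurable; fun_prop)]
    refine lintegral_mono_ae ?_
    filter_upwards [hmp.ae (ENNReal.ae_le_essSup (μ := volume) f)] with z hz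
    exact mul_le_mul' le_rfl hz
  · obtain ⟨C, hC, h⟩ := exists_lintegral_dyadicMax_rpow_le (E := E) (m := 1 / a)
      (by rw [lt_div_iff₀ ha]; linarith)
    refine ⟨C ^ a, ENNReal.rpow_ne_top_of_nonneg ha.le hC, fun f hf => ?_⟩
    rw [recipNorm_of_pos ha, recipNorm_of_pos ha, ← ENNReal.mul_rpow_of_nonneg _ _ ha.le]
    exact ENNReal.rpow_le_rpow (h f hf) ha.le

theorem min_le_rpow_mul_rpow (A B : ℝ≥0∞) {θ : ℝ} (h0 : 0 ≤ θ) (h1 : θ ≤ 1) :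
    min A B ≤ A ^ (1 - θ) * B ^ θ := by
  calc min A B = min A B ^ (1 - θ) * min A B ^ θ := by
        rw [← ENNReal.rpow_add_of_nonneg _ _ (by linarith) h0]; simp
    _ ≤ _ := mul_le_mul' (ENNReal.rpow_le_rpow (min_le_left _ _) (by linarith))
        (ENNReal.rpow_le_rpow (min_le_right _ _) h0)

/-- Bound of a dyadic piece obtained by comparing with `U` and with `2^{-js} U'`. -/
noncomputable def pieceBound (s : ℝ) (U U' : E → ℝ≥0∞) (j : ℤ) (x : E) : ℝ≥0∞ :=
  min (dyadicMax U x) ((2 : ℝ≥0∞) ^ (-(j * s)) * dyadicMax U' x)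

/-- The products of `f` and `g` with maximal functions that control a bilinear piece. -/
noncomputable def maxProd (f g : E → ℝ≥0∞) (x : E) : ℝ≥0∞ :=
  f x * g x + f x * dyadicMax g x + dyadicMax (fun y => f y * g y) x

theorem measurable_pieceBound (s : ℝ) {U U' : E → ℝ≥0∞} (hU : Measurable U)
    (hU' : Measurable U') (j : ℤ) : Measurable (pieceBound s U U' j) := by
  have := measurable_dyadicMax hU
  have := measurable_dyadicMax hU'
  unfold pieceBound; fun_prop

theorem measurable_maxProd {f g : E → ℝ≥0∞} (hf : Measurable f) (hg : Measurable g) :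
    Measurable (maxProd f g) := by
  have := measurable_dyadicMax hg
  have := measurable_dyadicMax (hf.mul hg)
  unfold maxProd
  exact ((hf.mul hg).add (hf.mul ‹_›)).add this

theorem maxProd_const_mul_le {f g f' g' : E → ℝ≥0∞} {c c' : ℝ≥0∞} (hc : c ≠ ∞) (hc' : c' ≠ ∞)
    (hf : ∀ x, f x ≤ c * f' x) (hg : ∀ x, g x ≤ c' * g' x) (x : E) :
    maxProd f g x ≤ c * c' * maxProd f' g' x := by
  have h1 : dyadicMax g x ≤ c' * dyadicMax g' x := by
    rw [← dyadicMax_const_mul c' hc']; exact dyadicMax_mono hg x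
  have h2 : dyadicMax (fun y => f y * g y) x ≤ c * c' * dyadicMax (fun y => f' y * g' y) x := by
    rw [← dyadicMax_const_mul _ (ENNReal.mul_ne_top hc hc')]
    refine dyadicMax_mono (fun y => (mul_le_mul' (hf y) (hg y)).trans (le_of_eq ?_)) x
    ring
  calc maxProd f g x ≤ (c * f' x) * (c' * g' x) + (c * f' x) * (c' * dyadicMax g' x)
        + c * c' * dyadicMax (fun y => f' y * g' y) x :=
        add_le_add (add_le_add (mul_le_mul' (hf x) (hg x)) (mul_le_mul' (hf x) h1)) h2
    _ = _ := by unfold maxProd; ring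

theorem exists_recipNorm_maxProd_le {a b : ℝ} (ha : 0 ≤ a) (hb : 0 < b) (hab : a + b < 1) :
    ∃ C : ℝ≥0∞, C ≠ ∞ ∧ ∀ f g : E → ℝ≥0∞, Measurable f → Measurable g →
      recipNorm (a + b) (maxProd f g) ≤ C * (recipNorm a f * recipNorm b g) := by
  obtain ⟨C₁, h₁t, h₁⟩ := exists_recipNorm_dyadicMax_le (E := E) hb.le (by linarith)
  obtain ⟨C₂, h₂t, h₂⟩ := exists_recipNorm_dyadicMax_le (E := E) (a := a + b) (by linarith) hab
  refine ⟨1 + C₁ + C₂, by simp [h₁t, h₂t], fun f g hf hg => ?_⟩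
  have hab0 : 0 < a + b := by linarith
  have hMg := measurable_dyadicMax hg
  have hM := measurable_dyadicMax (hf.mul hg)
  calc recipNorm (a + b) (maxProd f g)
      ≤ recipNorm (a + b) (fun x => f x * g x) + recipNorm (a + b) (fun x => f x * dyadicMax g x)
        + recipNorm (a + b) (dyadicMax fun y => f y * g y) := by
        refine (recipNorm_add_le hab0 hab.le ((hf.mul hg).add (hf.mul hMg)) hM).trans ?_
        exact add_le_add (recipNorm_add_le hab0 hab.le (hf.mul hg) (hf.mul hMg)) le_rfl
    _ ≤ recipNorm a f * recipNorm b g + recipNorm a f * (C₁ * recipNorm b g)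
        + C₂ * (recipNorm a f * recipNorm b g) := by
        refine add_le_add (add_le_add (recipNorm_mul_le ha hb hf hg) ?_) ?_
        · exact (recipNorm_mul_le ha hb hf hMg).trans (mul_le_mul' le_rfl (h₁ g hg))
        · exact (h₂ _ (hf.mul hg)).trans (mul_le_mul' le_rfl (recipNorm_mul_le ha hb hf hg))
    _ = _ := by ring

end ReciprocalExponent

section Interpolation

variable {E : Type*} [NormedAddCommGroup E] [InnerProductSpace ℝ E] [FiniteDimensional ℝ E]
  [MeasurableSpace E] [BorelSpace E]

/-- Geometric mean of two maximal functions. -/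
noncomputable def interpMax (θ : ℝ) (U U' : E → ℝ≥0∞) (x : E) : ℝ≥0∞ :=
  dyadicMax U x ^ (1 - θ) * dyadicMax U' x ^ θ

theorem measurable_interpMax (θ : ℝ) {U U' : E → ℝ≥0∞} (hU : Measurable U)
    (hU' : Measurable U') : Measurable (interpMax θ U U') := by
  have := measurable_dyadicMax hU
  have := measurable_dyadicMax hU'
  unfold interpMax; fun_prop

theorem pieceBound_le_interpMax (s : ℝ) {θ : ℝ} (h0 : 0 ≤ θ) (h1 : θ ≤ 1) (U U' : E → ℝ≥0∞)
    (j : ℤ) (x : E) :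
    pieceBound s U U' j x ≤ (2 : ℝ≥0∞) ^ (-(j * s * θ)) * interpMax θ U U' x := by
  refine (min_le_rpow_mul_rpow _ _ h0 h1).trans (le_of_eq ?_)
  rw [ENNReal.mul_rpow_of_nonneg _ _ h0, ← ENNReal.rpow_mul, neg_mul, interpMax]
  ring

theorem exists_recipNorm_interpMax_le {a b θ : ℝ} (ha : 0 ≤ a) (ha1 : a < 1) (hb : 0 < b)
    (hb1 : b < 1) (h0 : 0 < θ) (h1 : θ ≤ 1) : ∃ C : ℝ≥0∞, C ≠ ∞ ∧
    ∀ U U' : E → ℝ≥0∞, Measurable U → Measurable U' →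
      recipNorm ((1 - θ) * a + θ * b) (interpMax θ U U')
        ≤ C * (recipNorm a U ^ (1 - θ) * recipNorm b U' ^ θ) := by
  obtain ⟨C₁, h₁t, h₁⟩ := exists_recipNorm_dyadicMax_le (E := E) ha ha1
  obtain ⟨C₂, h₂t, h₂⟩ := exists_recipNorm_dyadicMax_le (E := E) hb.le hb1
  have h1' : 0 ≤ 1 - θ := by linarith
  refine ⟨C₁ ^ (1 - θ) * C₂ ^ θ, ENNReal.mul_ne_top (ENNReal.rpow_ne_top_of_nonneg h1' h₁t)
    (ENNReal.rpow_ne_top_of_nonneg h0.le h₂t), fun U U' hU hU' => ?_⟩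
  calc _ ≤ recipNorm a (dyadicMax U) ^ (1 - θ) * recipNorm b (dyadicMax U') ^ θ :=
        recipNorm_rpow_mul_rpow_le ha hb h1' h0 (measurable_dyadicMax hU)
          (measurable_dyadicMax hU')
    _ ≤ (C₁ * recipNorm a U) ^ (1 - θ) * (C₂ * recipNorm b U') ^ θ :=
        mul_le_mul' (ENNReal.rpow_le_rpow (h₁ U hU) h1') (ENNReal.rpow_le_rpow (h₂ U' hU') h0.le)
    _ = _ := by
        rw [ENNReal.mul_rpow_of_nonneg _ _ h1', ENNReal.mul_rpow_of_nonneg _ _ h0.le]; ring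

theorem rpow_mul_rpow_le_add (x y : ℝ≥0∞) {θ : ℝ} (h0 : 0 ≤ θ) (h1 : θ ≤ 1) :
    x ^ (1 - θ) * y ^ θ ≤ x + y := by
  calc x ^ (1 - θ) * y ^ θ ≤ (x + y) ^ (1 - θ) * (x + y) ^ θ :=
        mul_le_mul' (ENNReal.rpow_le_rpow le_self_add (by linarith))
          (ENNReal.rpow_le_rpow le_add_self h0)
    _ = x + y := by rw [← ENNReal.rpow_add_of_nonneg _ _ (by linarith) h0]; simp

/-- The double sum over dyadic frequencies of the bounds for the bilinear pieces. -/
noncomputable def paraSum (s : ℝ) (U U' V V' : E → ℝ≥0∞) (x : E) : ℝ≥0∞ :=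
  ∑' k : ℤ, ∑' i : ℕ, (2 : ℝ≥0∞) ^ (k * s - i / 2) *
    maxProd (pieceBound s U U' (k - i)) (pieceBound s V V' k) x

theorem measurable_paraSum (s : ℝ) {U U' V V' : E → ℝ≥0∞} (hU : Measurable U)
    (hU' : Measurable U') (hV : Measurable V) (hV' : Measurable V') :
    Measurable (paraSum s U U' V V') := by
  unfold paraSum
  exact Measurable.ennreal_tsum fun k => Measurable.ennreal_tsum fun i =>
    (measurable_maxProd (measurable_pieceBound s hU hU' _)
      (measurable_pieceBound s hV hV' _)).const_mul _

theorem maxProd_pieceBound_le {s δ θ : ℝ} (hδ0 : 0 ≤ δ) (hδ1 : δ ≤ 1) (hθ0 : 0 ≤ θ)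
    (hθ1 : θ ≤ 1) (hθ : s * θ ≤ 3 / 8) (U U' V V' : E → ℝ≥0∞) (k : ℤ) (i : ℕ) (x : E) :
    (2 : ℝ≥0∞) ^ (k * s - i / 2) *
        maxProd (pieceBound s U U' (k - i)) (pieceBound s V V' k) x
      ≤ (2 : ℝ≥0∞) ^ (-(i * (1 / 8 : ℝ))) * ((2 : ℝ≥0∞) ^ (k * (s * (δ - θ))) *
        maxProd (interpMax θ U U') (interpMax (1 - δ) V V') x) := by
  have h := maxProd_const_mul_le (two_rpow_ne_top _) (two_rpow_ne_top _)
    (pieceBound_le_interpMax s hθ0 hθ1 U U' (k - i))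
    (pieceBound_le_interpMax s (sub_nonneg.2 hδ1) (by linarith) V V' k) x
  refine (mul_le_mul' le_rfl h).trans ?_
  rw [← mul_assoc, ← mul_assoc, ← mul_assoc, ← two_rpow_add, ← two_rpow_add, ← two_rpow_add]
  refine mul_le_mul' (two_rpow_mono ?_) le_rfl
  push_cast
  nlinarith [mul_nonneg (Nat.cast_nonneg (α := ℝ) i) (sub_nonneg.2 hθ)]

theorem exists_recipNorm_paraSum_le {a b s : ℝ} (ha : 0 ≤ a) (hb : 0 < b) (hab : a + b < 1)
    (hs : 1 ≤ s) : ∃ C : ℝ≥0∞, C ≠ ∞ ∧ ∀ U U' V V' : E → ℝ≥0∞, Measurable U → Measurable U' →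
      Measurable V → Measurable V' →
      recipNorm (a + b) (paraSum s U U' V V')
        ≤ C * (recipNorm a U * recipNorm b V' + recipNorm a V * recipNorm b U') := by
  have hs0 : 0 < s := by linarith
  set δ : ℝ := 1 / (4 * s) with hδ
  have hδ0 : 0 < δ := by positivity
  have hδs : s * δ = 1 / 4 := by rw [hδ]; field_simp
  have hδ4 : δ ≤ 1 / 4 := by rw [hδ]; apply one_div_le_one_div_of_le <;> linarith
  obtain ⟨ε, hε0, hεδ, hεab⟩ : ∃ ε : ℝ, 0 < ε ∧ ε ≤ δ / 2 ∧ ε ≤ (1 - a - b) / 2 :=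
    ⟨min (δ / 2) ((1 - a - b) / 2), lt_min (by linarith) (by linarith), min_le_left _ _,
      min_le_right _ _⟩
  obtain ⟨S, hSt, hS⟩ := tsum_min_two_rpow_le (α := s * ε) (by positivity)
  set S' := ∑' i : ℕ, (2 : ℝ≥0∞) ^ (-(i * (1 / 8 : ℝ))) with hS'
  have hS't : S' ≠ ∞ := tsum_two_rpow_neg_ne_top (by norm_num)
  have key : ∀ θ : ℝ, δ - ε ≤ θ → θ ≤ δ + ε → ∃ C : ℝ≥0∞, C ≠ ∞ ∧
      ∀ U U' V V' : E → ℝ≥0∞, Measurable U → Measurable U' → Measurable V → Measurable V' →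
      recipNorm (((1 - θ) * a + θ * b) + (δ * a + (1 - δ) * b))
        (maxProd (interpMax θ U U') (interpMax (1 - δ) V V'))
        ≤ C * (recipNorm a U ^ (1 - θ) * recipNorm b U' ^ θ *
          (recipNorm a V ^ δ * recipNorm b V' ^ (1 - δ))) := by
    intro θ h1 h2
    have hθ0 : 0 < θ := by linarith
    have hθ1 : θ < 1 := by linarith
    obtain ⟨C₁, h₁t, h₁⟩ := exists_recipNorm_interpMax_le (E := E) ha (by linarith) hb
      (by linarith) hθ0 hθ1.le
    obtain ⟨C₂, h₂t, h₂⟩ := exists_recipNorm_interpMax_le (E := E) (θ := 1 - δ) ha (by linarith) hb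
      (by linarith) (by linarith) (by linarith)
    rw [sub_sub_cancel] at h₂
    have hsum : ((1 - θ) * a + θ * b) + (δ * a + (1 - δ) * b) < 1 := by
      have : |(θ - δ) * (b - a)| ≤ ε * 1 := by
        rw [abs_mul]
        exact mul_le_mul (abs_le.2 ⟨by linarith, by linarith⟩)
          (abs_le.2 ⟨by linarith, by linarith⟩) (abs_nonneg _) hε0.le
      nlinarith [abs_le.1 this]
    obtain ⟨C₃, h₃t, h₃⟩ := exists_recipNorm_maxProd_le (E := E) (a := (1 - θ) * a + θ * b)
      (b := δ * a + (1 - δ) * b) (by have := sub_pos.2 hθ1; positivity)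
      (by have : 0 < 1 - δ := by linarith
          positivity) hsum
    refine ⟨C₃ * (C₁ * C₂), by finiteness, fun U U' V V' hU hU' hV hV' => ?_⟩
    refine (h₃ _ _ (measurable_interpMax _ hU hU') (measurable_interpMax _ hV hV')).trans ?_
    refine (mul_le_mul' le_rfl (mul_le_mul' (h₁ U U' hU hU') (h₂ V V' hV hV'))).trans
      (le_of_eq ?_)
    ring
  obtain ⟨C₁, h₁t, h₁⟩ := key (δ + ε) (by linarith) le_rfl
  obtain ⟨C₂, h₂t, h₂⟩ := key (δ - ε) le_rfl (by linarith)
  refine ⟨S' * S * (C₁ * C₂) ^ (1 / 2 : ℝ), by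
    have : (C₁ * C₂) ^ (1 / 2 : ℝ) ≠ ∞ :=
      ENNReal.rpow_ne_top_of_nonneg (by norm_num) (ENNReal.mul_ne_top h₁t h₂t)
    finiteness, fun U U' V V' hU hU' hV hV' => ?_⟩
  set X := maxProd (interpMax (δ + ε) U U') (interpMax (1 - δ) V V') with hX
  set Y := maxProd (interpMax (δ - ε) U U') (interpMax (1 - δ) V V') with hY
  have hXm : Measurable X := measurable_maxProd (measurable_interpMax _ hU hU')
    (measurable_interpMax _ hV hV')
  have hYm : Measurable Y := measurable_maxProd (measurable_interpMax _ hU hU')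
    (measurable_interpMax _ hV hV')
  have pt : ∀ x, paraSum s U U' V V' x
      ≤ S' * S * (X x ^ (1 / 2 : ℝ) * Y x ^ (1 / 2 : ℝ)) := by
    intro x
    calc paraSum s U U' V V' x
        ≤ ∑' k : ℤ, ∑' i : ℕ, (2 : ℝ≥0∞) ^ (-(i * (1 / 8 : ℝ))) *
          min ((2 : ℝ≥0∞) ^ (-(k * (s * ε))) * X x) ((2 : ℝ≥0∞) ^ (k * (s * ε)) * Y x) := by
          refine ENNReal.tsum_le_tsum fun k => ENNReal.tsum_le_tsum fun i => ?_
          rw [mul_min]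
          refine le_min ?_ ?_
          · refine (maxProd_pieceBound_le (θ := δ + ε) hδ0.le (by linarith) (by linarith)
              (by linarith) (by nlinarith) U U' V V' k i x).trans (le_of_eq ?_)
            rw [hX]; congr 3; ring
          · refine (maxProd_pieceBound_le (θ := δ - ε) hδ0.le (by linarith) (by linarith)
              (by linarith) (by nlinarith) U U' V V' k i x).trans (le_of_eq ?_)
            rw [hY]; congr 3; ring
      _ = S' * ∑' k : ℤ, min ((2 : ℝ≥0∞) ^ (-(k * (s * ε))) * X x)
            ((2 : ℝ≥0∞) ^ (k * (s * ε)) * Y x) := by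
          simp_rw [ENNReal.tsum_mul_right]
          rw [ENNReal.tsum_mul_left]
      _ ≤ S' * (S * (X x * Y x) ^ (1 / 2 : ℝ)) := mul_le_mul' le_rfl (hS _ _)
      _ = _ := by rw [ENNReal.mul_rpow_of_nonneg _ _ (by norm_num)]; ring
  refine (recipNorm_mono (by linarith) pt).trans ?_
  rw [recipNorm_const_mul (by linarith) _ (ENNReal.mul_ne_top hS't hSt), mul_assoc (S' * S)]
  refine mul_le_mul' le_rfl ?_
  have hpos : ∀ θ : ℝ, 0 < θ → θ < 1 → 0 < ((1 - θ) * a + θ * b) + (δ * a + (1 - δ) * b) := by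
    intro θ h0 h1
    have : 0 < 1 - δ := by linarith
    have := sub_pos.2 h1
    positivity
  have e : a + b = 1 / 2 * (((1 - (δ + ε)) * a + (δ + ε) * b) + (δ * a + (1 - δ) * b)) +
      1 / 2 * (((1 - (δ - ε)) * a + (δ - ε) * b) + (δ * a + (1 - δ) * b)) := by ring
  rw [e]
  refine (recipNorm_rpow_mul_rpow_le (hpos _ (by linarith) (by linarith)).le
    (hpos _ (by linarith) (by linarith)) (by norm_num) (by norm_num) hXm hYm).trans ?_
  have hh := fun x y : ℝ≥0∞ => ENNReal.mul_rpow_of_nonneg x y (by norm_num : (0 : ℝ) ≤ 1 / 2)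
  rw [← hh]
  set A := recipNorm a U
  set B := recipNorm b U'
  set A' := recipNorm a V
  set B' := recipNorm b V'
  calc _ ≤ (C₁ * (A ^ (1 - (δ + ε)) * B ^ (δ + ε) * (A' ^ δ * B' ^ (1 - δ))) *
        (C₂ * (A ^ (1 - (δ - ε)) * B ^ (δ - ε) * (A' ^ δ * B' ^ (1 - δ))))) ^ (1 / 2 : ℝ) := by
        refine ENNReal.rpow_le_rpow (mul_le_mul' ?_ ?_) (by norm_num)
        · exact h₁ U U' V V' hU hU' hV hV'
        · exact h₂ U U' V V' hU hU' hV hV'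
    _ = (C₁ * C₂) ^ (1 / 2 : ℝ) * ((A * B') ^ (1 - δ) * (A' * B) ^ δ) := by
        have e1 : A ^ (1 - (δ + ε)) * A ^ (1 - (δ - ε)) = A ^ (2 * (1 - δ)) := by
          rw [← ENNReal.rpow_add_of_nonneg _ _ (by linarith) (by linarith)]; congr 1; ring
        have e2 : B ^ (δ + ε) * B ^ (δ - ε) = B ^ (2 * δ) := by
          rw [← ENNReal.rpow_add_of_nonneg _ _ (by linarith) (by linarith)]; congr 1; ring
        have e3 : A' ^ δ * A' ^ δ = A' ^ (2 * δ) := by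
          rw [← ENNReal.rpow_add_of_nonneg _ _ (by linarith) (by linarith)]; congr 1; ring
        have e4 : B' ^ (1 - δ) * B' ^ (1 - δ) = B' ^ (2 * (1 - δ)) := by
          rw [← ENNReal.rpow_add_of_nonneg _ _ (by linarith) (by linarith)]; congr 1; ring
        have e5 : C₁ * (A ^ (1 - (δ + ε)) * B ^ (δ + ε) * (A' ^ δ * B' ^ (1 - δ))) *
            (C₂ * (A ^ (1 - (δ - ε)) * B ^ (δ - ε) * (A' ^ δ * B' ^ (1 - δ))))
            = (C₁ * C₂) * (A ^ (2 * (1 - δ)) * B ^ (2 * δ) * (A' ^ (2 * δ) *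
              B' ^ (2 * (1 - δ)))) := by
          rw [← e1, ← e2, ← e3, ← e4]; ring
        rw [e5]
        simp only [hh, ← ENNReal.rpow_mul]
        rw [ENNReal.mul_rpow_of_nonneg _ _ (by linarith : 0 ≤ 1 - δ),
          ENNReal.mul_rpow_of_nonneg _ _ hδ0.le]
        have e6 : 2 * (1 - δ) * (1 / 2) = 1 - δ := by ring
        have e7 : 2 * δ * (1 / 2) = δ := by ring
        rw [e6, e7]; ring
    _ ≤ _ := mul_le_mul' le_rfl (rpow_mul_rpow_le_add _ _ hδ0.le (by linarith))

end Interpolation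

section Cutoff

variable {E : Type*} [NormedAddCommGroup E] [InnerProductSpace ℝ E] [FiniteDimensional ℝ E]
  [MeasurableSpace E] [BorelSpace E]

/-- A smooth bump equal to `1` on the unit ball and supported in the ball of radius `2`. -/
noncomputable def unitBump : E → ℝ :=
  ⇑(⟨1, 2, one_pos, one_lt_two⟩ : ContDiffBump (0 : E))

theorem unitBump_eq_one {ξ : E} (h : ‖ξ‖ ≤ 1) : unitBump ξ = 1 :=
  ContDiffBump.one_of_mem_closedBall _ (by simpa using h)

theorem unitBump_eq_zero {ξ : E} (h : 2 ≤ ‖ξ‖) : unitBump ξ = 0 :=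
  ContDiffBump.zero_of_le_dist _ (by simpa using h)

theorem unitBump_le_one (ξ : E) : unitBump ξ ≤ 1 := ContDiffBump.le_one _

theorem unitBump_nonneg (ξ : E) : 0 ≤ unitBump ξ := ContDiffBump.nonneg _

theorem contDiff_unitBump : ContDiff ℝ ((⊤ : ℕ∞) : WithTop ℕ∞) (unitBump : E → ℝ) :=
  ContDiffBump.contDiff _

/-- The annular cut-off. -/
noncomputable def annulusBump (ξ : E) : ℝ := unitBump ξ - unitBump ((2 : ℝ) • ξ)

theorem annulusBump_nonneg (ξ : E) : 0 ≤ annulusBump ξ := by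
  unfold annulusBump
  rcases le_total ‖ξ‖ 1 with h | h
  · rw [unitBump_eq_one h]; linarith [unitBump_le_one ((2 : ℝ) • ξ)]
  · rw [unitBump_eq_zero (ξ := (2 : ℝ) • ξ) (by rw [norm_smul]; norm_num; linarith)]
    linarith [unitBump_nonneg ξ]

theorem annulusBump_le_one (ξ : E) : annulusBump ξ ≤ 1 := by
  unfold annulusBump
  linarith [unitBump_le_one ξ, unitBump_nonneg ((2 : ℝ) • ξ)]

theorem annulusBump_eq_zero_of_le {ξ : E} (h : ‖ξ‖ ≤ 1 / 2) : annulusBump ξ = 0 := by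
  unfold annulusBump
  rw [unitBump_eq_one (by linarith), unitBump_eq_one (by rw [norm_smul]; norm_num; linarith),
    sub_self]

theorem annulusBump_eq_zero_of_ge {ξ : E} (h : 2 ≤ ‖ξ‖) : annulusBump ξ = 0 := by
  unfold annulusBump
  rw [unitBump_eq_zero h, unitBump_eq_zero (by rw [norm_smul]; norm_num; linarith), sub_self]

theorem contDiff_annulusBump : ContDiff ℝ ((⊤ : ℕ∞) : WithTop ℕ∞) (annulusBump : E → ℝ) := by
  unfold annulusBump
  exact contDiff_unitBump.sub (contDiff_unitBump.comp (contDiff_const_smul _))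

theorem continuous_annulusBump : Continuous (annulusBump : E → ℝ) :=
  contDiff_annulusBump.continuous

/-- The cut-off to frequencies of size about `2^j`. -/
noncomputable def dyadicBump (j : ℤ) (ξ : E) : ℝ := annulusBump ((2 : ℝ) ^ (-(j : ℝ)) • ξ)

theorem dyadicBump_nonneg (j : ℤ) (ξ : E) : 0 ≤ dyadicBump j ξ := annulusBump_nonneg _

theorem dyadicBump_le_one (j : ℤ) (ξ : E) : dyadicBump j ξ ≤ 1 := annulusBump_le_one _

theorem continuous_dyadicBump (j : ℤ) : Continuous (dyadicBump j : E → ℝ) :=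
  continuous_annulusBump.comp (continuous_const_smul _)

theorem norm_two_rpow_smul (j : ℝ) (ξ : E) : ‖(2 : ℝ) ^ (-j) • ξ‖ = ‖ξ‖ / 2 ^ j := by
  rw [norm_smul, Real.norm_of_nonneg (by positivity), Real.rpow_neg (by norm_num)]
  field_simp

theorem dyadicBump_eq_zero_of_le {j : ℤ} {ξ : E} (h : ‖ξ‖ ≤ 2 ^ ((j : ℝ) - 1)) :
    dyadicBump j ξ = 0 := by
  apply annulusBump_eq_zero_of_le
  rw [norm_two_rpow_smul, div_le_iff₀ (by positivity)]
  rw [Real.rpow_sub two_pos, Real.rpow_one] at h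
  linarith

theorem dyadicBump_eq_zero_of_ge {j : ℤ} {ξ : E} (h : (2 : ℝ) ^ ((j : ℝ) + 1) ≤ ‖ξ‖) :
    dyadicBump j ξ = 0 := by
  apply annulusBump_eq_zero_of_ge
  rw [norm_two_rpow_smul, le_div_iff₀ (by positivity)]
  rw [Real.rpow_add two_pos, Real.rpow_one] at h
  linarith

theorem hasSum_dyadicBump {ξ : E} (hξ : ξ ≠ 0) : HasSum (fun j : ℤ => dyadicBump j ξ) 1 := by
  have hξ' : 0 < ‖ξ‖ := norm_pos_iff.2 hξ
  obtain ⟨n, hn⟩ : ∃ n : ℕ, ‖ξ‖ ≤ 2 ^ n := by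
    obtain ⟨n, hn⟩ := pow_unbounded_of_one_lt ‖ξ‖ one_lt_two
    exact ⟨n, hn.le⟩
  set g : ℕ → ℝ := fun i => dyadicBump ((n : ℤ) - i) ξ with hg
  have htel : ∀ m : ℕ, ∑ i ∈ Finset.range m, g i
      = 1 - unitBump ((2 : ℝ) ^ ((m : ℝ) - n) • ξ) := by
    intro m
    induction m with
    | zero =>
      have : ‖(2 : ℝ) ^ (-(n : ℝ)) • ξ‖ ≤ 1 := by
        rw [norm_two_rpow_smul, div_le_one (by positivity), Real.rpow_natCast]; exact hn
      rw [Nat.cast_zero, zero_sub, unitBump_eq_one this]; simp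
    | succ m ih =>
      rw [Finset.sum_range_succ, ih, hg]
      simp only [dyadicBump, annulusBump, smul_smul]
      have e1 : (2 : ℝ) ^ (-(((n : ℤ) - m : ℤ) : ℝ)) = 2 ^ ((m : ℝ) - n) := by
        congr 1; push_cast; ring
      have e2 : (2 : ℝ) * 2 ^ ((m : ℝ) - n) = 2 ^ (((m + 1 : ℕ) : ℝ) - n) := by
        rw [show (((m + 1 : ℕ) : ℝ) - n) = 1 + ((m : ℝ) - n) by push_cast; ring,
          Real.rpow_add two_pos, Real.rpow_one]
      rw [e1, e2]; ring
  have hgs : HasSum g 1 := by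
    rw [hasSum_iff_tendsto_nat_of_nonneg fun i => dyadicBump_nonneg _ _]
    obtain ⟨M, hM⟩ := pow_unbounded_of_one_lt (2 * 2 ^ n / ‖ξ‖) one_lt_two
    refine tendsto_const_nhds.congr' ?_
    filter_upwards [eventually_ge_atTop M] with m hm
    rw [htel, unitBump_eq_zero, sub_zero]
    rw [norm_smul, Real.norm_of_nonneg (by positivity), Real.rpow_sub two_pos,
      Real.rpow_natCast, Real.rpow_natCast]
    have h1 : (2 : ℝ) ^ M ≤ 2 ^ m := pow_le_pow_right₀ one_le_two hm
    rw [div_lt_iff₀ hξ'] at hM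
    rw [div_mul_eq_mul_div, le_div_iff₀ (by positivity)]
    nlinarith
  have hinj : Function.Injective (fun i : ℕ => (n : ℤ) - i) := fun a b h => by
    simpa using h
  refine (hinj.hasSum_iff ?_).1 hgs
  intro j hj
  have hjn : (n : ℤ) + 1 ≤ j := by
    by_contra hcon
    refine hj ⟨(n - j).toNat, ?_⟩
    simp only
    omega
  apply dyadicBump_eq_zero_of_le
  refine hn.trans ?_
  rw [← Real.rpow_natCast]
  refine Real.rpow_le_rpow_of_exponent_le one_le_two ?_
  have : ((n : ℝ)) + 1 ≤ j := by exact_mod_cast hjn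
  linarith

/-- The profile `|ξ|^σ` cut off to the unit annulus. -/
noncomputable def annulusPow (σ : ℝ) (ξ : E) : ℂ := ((‖ξ‖ ^ σ * annulusBump ξ : ℝ) : ℂ)

theorem contDiff_annulusPow (σ : ℝ) : ContDiff ℝ ((⊤ : ℕ∞) : WithTop ℕ∞) (annulusPow σ : E → ℂ) := by
  refine Complex.ofRealCLM.contDiff.comp (contDiff_iff_contDiffAt.2 fun ξ => ?_)
  by_cases hξ : ξ = 0
  · have : (fun η : E => ‖η‖ ^ σ * annulusBump η) =ᶠ[𝓝 ξ] fun _ => 0 := by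
      filter_upwards [Metric.ball_mem_nhds ξ (by norm_num : (0 : ℝ) < 1 / 2)] with η hη
      rw [annulusBump_eq_zero_of_le, mul_zero]
      rw [hξ, mem_ball_zero_iff] at hη
      exact hη.le
    exact contDiffAt_const.congr_of_eventuallyEq this
  · exact ((contDiffAt_norm ℝ hξ).rpow_const_of_ne (norm_ne_zero_iff.2 hξ)).mul
      contDiff_annulusBump.contDiffAt

theorem hasCompactSupport_annulusPow (σ : ℝ) : HasCompactSupport (annulusPow σ : E → ℂ) := by
  refine HasCompactSupport.intro (isCompact_closedBall (0 : E) 2) fun ξ hξ => ?_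
  rw [mem_closedBall_zero_iff, not_le] at hξ
  simp [annulusPow, annulusBump_eq_zero_of_ge hξ.le]

/-- The convolution kernel of the multiplier `annulusPow σ`. -/
noncomputable def annulusKernel (σ : ℝ) : 𝓢(E, ℂ) :=
  𝓕⁻ ((hasCompactSupport_annulusPow (E := E) σ).toSchwartzMap (contDiff_annulusPow σ))

theorem fourier_annulusKernel (σ : ℝ) (ξ : E) :
    𝓕 (⇑(annulusKernel (E := E) σ)) ξ = annulusPow σ ξ := by
  rw [← SchwartzMap.fourier_coe, annulusKernel, FourierTransform.fourier_fourierInv_eq]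
  rfl

theorem annulusPow_two_rpow_smul (σ : ℝ) (j : ℤ) (ξ : E) :
    (((2 : ℝ) ^ (j * σ) : ℝ) : ℂ) * annulusPow σ ((2 : ℝ) ^ (-(j : ℝ)) • ξ)
      = ((‖ξ‖ ^ σ * dyadicBump j ξ : ℝ) : ℂ) := by
  rw [annulusPow, norm_two_rpow_smul, Real.div_rpow (norm_nonneg _) (by positivity), dyadicBump,
    ← Real.rpow_mul two_pos.le, ← Complex.ofReal_mul]
  congr 1
  field_simp

theorem annulusPow_neg_mul (σ : ℝ) (hσ : 0 < σ) (j : ℤ) (ξ : E) :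
    annulusPow (-σ) ((2 : ℝ) ^ (-(j : ℝ)) • ξ) * ((‖ξ‖ ^ σ : ℝ) : ℂ)
      = (((2 : ℝ) ^ (j * σ) * dyadicBump j ξ : ℝ) : ℂ) := by
  have h := annulusPow_two_rpow_smul (-σ) j ξ
  by_cases hξ : ξ = 0
  · have : dyadicBump j ξ = 0 := by
      apply dyadicBump_eq_zero_of_le; rw [hξ, norm_zero]; positivity
    rw [this, hξ, norm_zero, Real.zero_rpow hσ.ne']; simp
  · have h2 : ((2 : ℝ) ^ (j * -σ) : ℝ) ≠ 0 := by positivity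
    have h2' : (((2 : ℝ) ^ (j * -σ) : ℝ) : ℂ) ≠ 0 := Complex.ofReal_ne_zero.2 h2
    apply mul_left_cancel₀ h2'
    rw [← mul_assoc, h, ← Complex.ofReal_mul, ← Complex.ofReal_mul]
    congr 1
    rw [← mul_assoc, ← Real.rpow_add two_pos, Real.rpow_neg (norm_nonneg _)]
    have : ‖ξ‖ ^ σ ≠ 0 := (Real.rpow_pos_of_pos (norm_pos_iff.2 hξ) _).ne'
    field_simp
    simp

end Cutoff

section Wave

variable {E : Type*} [NormedAddCommGroup E] [InnerProductSpace ℝ E]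

/-- The plane wave of frequency `ξ`. -/
noncomputable def wave (x ξ : E) : ℂ := (Real.fourierChar (inner ℝ ξ x) : ℂ)

theorem norm_wave (x ξ : E) : ‖wave x ξ‖ = 1 := Circle.norm_coe _

theorem continuous_wave : Continuous (fun p : E × E => wave p.1 p.2) := by
  unfold wave
  exact continuous_subtype_val.comp (Real.continuous_fourierChar.comp (by fun_prop))

theorem wave_add_right (x ξ η : E) : wave x (ξ + η) = wave x ξ * wave x η := by
  simp [wave, inner_add_left, AddChar.map_add_eq_mul]

theorem wave_neg_smul_mul (x z ξ : E) (t : ℝ) :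
    wave (-z) (t • ξ) * wave x ξ = wave (x - t • z) ξ := by
  simp only [wave, ← Circle.coe_mul, ← AddChar.map_add_eq_mul]
  congr 2
  simp [inner_smul_left, inner_smul_right, inner_sub_right]
  ring

end Wave

section Kernels

variable {E : Type*} [NormedAddCommGroup E] [InnerProductSpace ℝ E] [FiniteDimensional ℝ E]
  [MeasurableSpace E] [BorelSpace E]

theorem fourierInv_eq_wave (h : E → ℂ) (x : E) : 𝓕⁻ h x = ∫ ξ, h ξ * wave x ξ := by
  rw [Real.fourierInv_eq]
  congr 1; ext ξ
  rw [Circle.smul_def, smul_eq_mul, mul_comm]; rfl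

theorem fourier_eq_wave (h : E → ℂ) (ξ : E) : 𝓕 h ξ = ∫ z, h z * wave (-z) ξ := by
  rw [Real.fourier_eq]
  congr 1; ext z
  rw [Circle.smul_def, smul_eq_mul, mul_comm, wave, inner_neg_right, real_inner_comm]

theorem continuous_fourierInv {h : E → ℂ} (hh : Integrable h) : Continuous (𝓕⁻ h) := by
  have : 𝓕⁻ h = fun x => ∫ ξ, h ξ * wave x ξ := funext fun x => fourierInv_eq_wave h x
  rw [this]
  refine continuous_of_dominated (bound := fun ξ => ‖h ξ‖) (fun x => ?_)
    (fun x => ae_of_all _ fun ξ => ?_) hh.norm (ae_of_all _ fun ξ => ?_)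
  · exact hh.1.mul (continuous_wave.comp (Continuous.prodMk_right x)).aestronglyMeasurable
  · rw [norm_mul, norm_wave, mul_one]
  · exact continuous_const.mul (continuous_wave.comp (Continuous.prodMk_left ξ))

theorem measurable_wave_comp {X : Type*} [MeasurableSpace X] {f g : X → E} (hf : Measurable f)
    (hg : Measurable g) : Measurable fun w => wave (f w) (g w) :=
  (continuous_wave (E := E)).measurable.comp (hf.prodMk hg)

theorem norm_fourierInv_le (h : E → ℂ) (x : E) : ‖𝓕⁻ h x‖ ≤ ∫ ξ, ‖h ξ‖ := by
  rw [fourierInv_eq_wave]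
  refine (norm_integral_le_integral_norm _).trans (le_of_eq ?_)
  simp [norm_wave]

/-- A Fourier multiplier given by the transform of `κ` acts by convolution with `κ`. -/
theorem integral_fourier_smul_mul_wave {X : Type*} [MeasurableSpace X] {μ : Measure X} [SFinite μ]
    {κ : E → ℂ} (hκ : Integrable κ) {L : X → E} (hL : Measurable L) {H : X → ℂ}
    (hH : Integrable H μ) (t : ℝ) (x : E) :
    ∫ w, 𝓕 κ (t • L w) * (H w * wave x (L w)) ∂μ
      = ∫ z, κ z * ∫ w, H w * wave (x - t • z) (L w) ∂μ := by
  have hint : Integrable (Function.uncurry fun (w : X) (z : E) =>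
      κ z * (H w * wave (x - t • z) (L w))) (μ.prod volume) := by
    have h1 : Integrable (fun p : X × E => H p.1 * κ p.2) (μ.prod volume) := hH.mul_prod hκ
    have h2 : Measurable fun p : X × E => wave (x - t • p.2) (L p.1) :=
      measurable_wave_comp (by fun_prop) (by fun_prop)
    refine (h1.mul_bdd (c := 1) h2.aestronglyMeasurable
      (ae_of_all _ fun p => (norm_wave _ _).le)).congr (ae_of_all _ fun p => ?_)
    simp only [Function.uncurry]; ring
  calc _ = ∫ w, (∫ z, κ z * (H w * wave (x - t • z) (L w))) ∂μ := by
        refine integral_congr_ae (ae_of_all _ fun w => ?_)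
        simp only
        rw [fourier_eq_wave, ← integral_mul_const]
        congr 1; ext z
        rw [← wave_neg_smul_mul]; ring
    _ = ∫ z, ∫ w, κ z * (H w * wave (x - t • z) (L w)) ∂μ := integral_integral_swap hint
    _ = _ := by
        congr 1; ext z
        rw [integral_const_mul]

theorem fourierInv_fourier_smul_mul {κ : E → ℂ} (hκ : Integrable κ) {h : E → ℂ}
    (hh : Integrable h) (t : ℝ) (x : E) :
    𝓕⁻ (fun ξ => 𝓕 κ (t • ξ) * h ξ) x = ∫ z, κ z * 𝓕⁻ h (x - t • z) := by
  rw [fourierInv_eq_wave]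
  simp_rw [fourierInv_eq_wave, mul_assoc]
  exact integral_fourier_smul_mul_wave hκ measurable_id hh t x

theorem one_add_norm_pow_mul_decayWeight (z : E) :
    (1 + ‖z‖) ^ (Module.finrank ℝ E + 1) * decayWeight z = 1 := by
  unfold decayWeight; exact mul_inv_cancel₀ (by positivity)

theorem exists_one_add_norm_pow_mul_norm_le (κ : 𝓢(E, ℂ)) (n : ℕ) : ∃ C : ℝ, 0 ≤ C ∧
    ∀ z, (1 + ‖z‖) ^ n * ‖κ z‖ ≤ C * decayWeight z := by
  set m := n + (Module.finrank ℝ E + 1)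
  refine ⟨2 ^ m * ((Finset.Iic (m, 0)).sup fun m => SchwartzMap.seminorm ℝ m.1 m.2) κ,
    by positivity, fun z => ?_⟩
  have := SchwartzMap.one_add_le_sup_seminorm_apply (𝕜 := ℝ) (m := (m, 0)) le_rfl le_rfl κ z
  rw [norm_iteratedFDeriv_zero] at this
  have hw := decayWeight_pos z
  calc (1 + ‖z‖) ^ n * ‖κ z‖ = (1 + ‖z‖) ^ n *
        ((1 + ‖z‖) ^ (Module.finrank ℝ E + 1) * decayWeight z) * ‖κ z‖ := by
        rw [one_add_norm_pow_mul_decayWeight, mul_one]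
    _ = ((1 + ‖z‖) ^ m * ‖κ z‖) * decayWeight z := by rw [pow_add]; ring
    _ ≤ _ := mul_le_mul_of_nonneg_right this hw.le

theorem exists_norm_sub_le_decayWeight (κ : 𝓢(E, ℂ)) : ∃ C : ℝ, 0 ≤ C ∧ ∀ z a,
    ‖κ (z - a) - κ z‖ ≤ C * (‖a‖ * (1 + ‖a‖) ^ (Module.finrank ℝ E + 1)) * decayWeight z := by
  set m := Module.finrank ℝ E + 1
  set C := 2 ^ m * ((Finset.Iic (m, 1)).sup fun m => SchwartzMap.seminorm ℝ m.1 m.2) κ with hC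
  have hC0 : 0 ≤ C := by positivity
  refine ⟨C, hC0, fun z a => ?_⟩
  have hseg : ∀ y ∈ segment ℝ z (z - a),
      ‖fderiv ℝ κ y‖ ≤ C * (1 + ‖a‖) ^ m * decayWeight z := by
    intro y hy
    have hya : ‖z - y‖ ≤ ‖a‖ := by
      rw [segment_eq_image_lineMap] at hy
      obtain ⟨τ, hτ, rfl⟩ := hy
      rw [AffineMap.lineMap_apply]
      simp only [vsub_eq_sub, sub_sub_cancel_left, vadd_eq_add, smul_neg, sub_add_cancel_right,
        neg_neg, norm_smul]
      rw [Real.norm_of_nonneg hτ.1]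
      exact mul_le_of_le_one_left (norm_nonneg _) hτ.2
    have h1 := SchwartzMap.one_add_le_sup_seminorm_apply (𝕜 := ℝ) (m := (m, 1)) le_rfl le_rfl κ y
    rw [norm_iteratedFDeriv_one] at h1
    have h2 : 1 + ‖z‖ ≤ (1 + ‖a‖) * (1 + ‖y‖) := by
      have : ‖z‖ ≤ ‖z - y‖ + ‖y‖ := by simpa using norm_add_le (z - y) y
      nlinarith [norm_nonneg a, norm_nonneg y, mul_nonneg (norm_nonneg a) (norm_nonneg y)]
    have h3 : (1 + ‖z‖) ^ m ≤ (1 + ‖a‖) ^ m * (1 + ‖y‖) ^ m := by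
      rw [← mul_pow]; gcongr
    calc ‖fderiv ℝ κ y‖ = (1 + ‖z‖) ^ m * ‖fderiv ℝ κ y‖ * decayWeight z := by
          rw [mul_right_comm, one_add_norm_pow_mul_decayWeight, one_mul]
      _ ≤ ((1 + ‖a‖) ^ m * (1 + ‖y‖) ^ m) * ‖fderiv ℝ κ y‖ * decayWeight z := by
          have := (decayWeight_pos z).le
          gcongr
      _ = (1 + ‖a‖) ^ m * ((1 + ‖y‖) ^ m * ‖fderiv ℝ κ y‖) * decayWeight z := by ring
      _ ≤ (1 + ‖a‖) ^ m * C * decayWeight z := by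
          have := (decayWeight_pos z).le
          gcongr
      _ = _ := by ring
  have := Convex.norm_image_sub_le_of_norm_fderiv_le (fun y _ => κ.differentiableAt) hseg
    (convex_segment _ _) (left_mem_segment ℝ _ _) (right_mem_segment ℝ _ _)
  refine this.trans (le_of_eq ?_)
  simp; ring

/-- Convolution with a kernel of size `decayWeight` is controlled by the maximal function. -/
theorem enorm_integral_mul_comp_le_dyadicMax {k h : E → ℂ} {C : ℝ} (hC : 0 ≤ C)
    (hk : ∀ z, ‖k z‖ ≤ C * decayWeight z) (j : ℤ) (x : E) :
    ‖∫ z, k z * h (x - (2 : ℝ) ^ (-(j : ℝ)) • z)‖ₑ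
      ≤ ENNReal.ofReal C * dyadicMax (fun y => ‖h y‖ₑ) x := by
  refine (enorm_integral_le_lintegral_enorm _).trans ?_
  refine le_trans ?_ (mul_le_mul' le_rfl (lintegral_decayWeight_le_dyadicMax _ j x))
  rw [← lintegral_const_mul' _ _ ENNReal.ofReal_ne_top]
  refine lintegral_mono fun z => ?_
  rw [enorm_mul, ← mul_assoc, ← ENNReal.ofReal_mul hC]
  refine mul_le_mul' ?_ le_rfl
  rw [← ofReal_norm]
  exact ENNReal.ofReal_le_ofReal (hk z)

theorem exists_enorm_convolution_le (κ : 𝓢(E, ℂ)) : ∃ C : ℝ≥0∞, C ≠ ∞ ∧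
    ∀ (h f : E → ℂ) (j : ℤ), Continuous h → (∃ B, ∀ y, ‖h y‖ ≤ B) →
      (∀ x, f x = ∫ z, κ z * h (x - (2 : ℝ) ^ (-(j : ℝ)) • z)) →
      (∀ x, ‖f x‖ₑ ≤ C * dyadicMax (fun y => ‖h y‖ₑ) x) ∧
      ∀ x w, ‖f (x - w) - f x‖ₑ ≤ C * ENNReal.ofReal ((2 ^ (j : ℝ) * ‖w‖) *
        (1 + 2 ^ (j : ℝ) * ‖w‖) ^ (Module.finrank ℝ E + 1)) *
          dyadicMax (fun y => ‖h y‖ₑ) x := by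
  obtain ⟨C₁, hC₁, h₁⟩ := exists_one_add_norm_pow_mul_norm_le κ 0
  obtain ⟨C₂, hC₂, h₂⟩ := exists_norm_sub_le_decayWeight κ
  refine ⟨ENNReal.ofReal C₁ + ENNReal.ofReal C₂, by finiteness, fun h f j hh hB hf => ⟨?_, ?_⟩⟩
  · intro x
    rw [hf]
    refine (enorm_integral_mul_comp_le_dyadicMax hC₁ (by simpa using h₁) j x).trans ?_
    exact mul_le_mul' le_self_add le_rfl
  · intro x w
    obtain ⟨B, hB⟩ := hB
    set t : ℝ := (2 : ℝ) ^ (-(j : ℝ)) with ht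
    set a : E := (2 : ℝ) ^ (j : ℝ) • w with ha
    have hta : t • a = w := by
      rw [ht, ha, smul_smul, ← Real.rpow_add two_pos]; simp
    have hshift : f (x - w) = ∫ z, κ (z - a) * h (x - t • z) := by
      rw [hf, ← integral_sub_right_eq_self _ a]
      congr 1; ext z
      rw [smul_sub, hta]
      congr 2; abel
    have hm : AEStronglyMeasurable (fun z => h (x - t • z)) volume :=
      (hh.comp (by fun_prop)).aestronglyMeasurable
    have hi1 : Integrable fun z => κ z * h (x - t • z) :=
      κ.integrable.mul_bdd hm (ae_of_all _ fun z => hB _)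
    have hi2 : Integrable fun z => κ (z - a) * h (x - t • z) :=
      (κ.integrable.comp_sub_right a).mul_bdd hm (ae_of_all _ fun z => hB _)
    rw [hshift, hf, ← integral_sub hi2 hi1]
    simp_rw [← sub_mul]
    have hna : ‖a‖ = 2 ^ (j : ℝ) * ‖w‖ := by
      rw [ha, norm_smul, Real.norm_of_nonneg (by positivity)]
    refine (enorm_integral_mul_comp_le_dyadicMax (k := fun z => κ (z - a) - κ z)
      (C := C₂ * (‖a‖ * (1 + ‖a‖) ^ (Module.finrank ℝ E + 1)))
      (by positivity) (fun z => h₂ z a) j x).trans ?_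
    rw [ENNReal.ofReal_mul hC₂, hna]
    exact mul_le_mul' (mul_le_mul' le_add_self le_rfl) le_rfl

end Kernels

section Pieces

variable {E : Type*} [NormedAddCommGroup E] [InnerProductSpace ℝ E] [FiniteDimensional ℝ E]
  [MeasurableSpace E] [BorelSpace E]

/-- Multiplication by `|ξ|^s` on the frequency side. -/
noncomputable def freqPow (s : ℝ) (φ : E → ℂ) (ξ : E) : ℂ := ((‖ξ‖ ^ s : ℝ) : ℂ) * φ ξ

/-- Localization to frequencies of size about `2^j`. -/
noncomputable def freqPiece (j : ℤ) (φ : E → ℂ) (ξ : E) : ℂ := (dyadicBump j ξ : ℂ) * φ ξ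

theorem norm_dyadicBump_le_one (j : ℤ) (ξ : E) : ‖(dyadicBump j ξ : ℂ)‖ ≤ 1 := by
  rw [Complex.norm_real, Real.norm_of_nonneg (dyadicBump_nonneg _ _)]
  exact dyadicBump_le_one _ _

theorem measurable_dyadicBump_ofReal (j : ℤ) :
    Measurable fun ξ : E => (dyadicBump j ξ : ℂ) :=
  Complex.measurable_ofReal.comp (continuous_dyadicBump j).measurable

theorem integrable_freqPiece {φ : E → ℂ} (hφ : Integrable φ) (j : ℤ) :
    Integrable (freqPiece j φ) :=
  hφ.bdd_mul (measurable_dyadicBump_ofReal j).aestronglyMeasurable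
    (ae_of_all _ (norm_dyadicBump_le_one j))

theorem freqPow_freqPiece (s : ℝ) (j : ℤ) (φ : E → ℂ) :
    freqPow s (freqPiece j φ) = freqPiece j (freqPow s φ) := by
  ext ξ; simp only [freqPow, freqPiece]; ring

theorem fourierInv_const_mul (c : ℂ) (h : E → ℂ) (x : E) :
    𝓕⁻ (fun ξ => c * h ξ) x = c * 𝓕⁻ h x := by
  simp_rw [fourierInv_eq_wave, mul_assoc, integral_const_mul]

theorem annulusPow_zero_smul (j : ℤ) (ξ : E) :
    annulusPow 0 ((2 : ℝ) ^ (-(j : ℝ)) • ξ) = (dyadicBump j ξ : ℂ) := by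
  simpa using annulusPow_two_rpow_smul 0 j ξ

theorem fourierInv_freqPiece {φ : E → ℂ} (hφ : Integrable φ) (j : ℤ) (x : E) :
    𝓕⁻ (freqPiece j φ) x
      = ∫ z, annulusKernel 0 z * 𝓕⁻ φ (x - (2 : ℝ) ^ (-(j : ℝ)) • z) := by
  rw [← fourierInv_fourier_smul_mul (annulusKernel (E := E) 0).integrable hφ]
  simp only [fourier_annulusKernel, annulusPow_zero_smul]
  rfl

theorem two_rpow_mul_fourierInv_freqPiece {s : ℝ} (hs : 0 < s) {φ : E → ℂ}
    (hφ : Integrable (freqPow s φ)) (j : ℤ) (x : E) :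
    (((2 : ℝ) ^ (j * s) : ℝ) : ℂ) * 𝓕⁻ (freqPiece j φ) x
      = ∫ z, annulusKernel (-s) z * 𝓕⁻ (freqPow s φ) (x - (2 : ℝ) ^ (-(j : ℝ)) • z) := by
  rw [← fourierInv_fourier_smul_mul (annulusKernel (E := E) (-s)).integrable hφ,
    ← fourierInv_const_mul]
  simp only [fourier_annulusKernel, freqPow, ← mul_assoc, annulusPow_neg_mul s hs]
  simp only [freqPiece, Complex.ofReal_mul, mul_assoc]

theorem fourierInv_freqPow_freqPiece (s : ℝ) {φ : E → ℂ} (hφ : Integrable φ) (j : ℤ) (x : E) :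
    𝓕⁻ (freqPow s (freqPiece j φ)) x = (((2 : ℝ) ^ (j * s) : ℝ) : ℂ) *
      ∫ z, annulusKernel s z * 𝓕⁻ φ (x - (2 : ℝ) ^ (-(j : ℝ)) • z) := by
  rw [← fourierInv_fourier_smul_mul (annulusKernel (E := E) s).integrable hφ,
    ← fourierInv_const_mul]
  simp only [fourier_annulusKernel, ← mul_assoc, annulusPow_two_rpow_smul]
  unfold freqPow freqPiece
  simp only [Complex.ofReal_mul, mul_assoc]

theorem enorm_two_rpow_mul (y : ℝ) (c : ℂ) :
    ‖(((2 : ℝ) ^ y : ℝ) : ℂ) * c‖ₑ = (2 : ℝ≥0∞) ^ y * ‖c‖ₑ := by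
  rw [enorm_mul, ← ofReal_norm, Complex.norm_real, Real.norm_of_nonneg (by positivity),
    ofReal_two_rpow]

theorem enorm_le_of_two_rpow_mul {y : ℝ} {c : ℂ} {A : ℝ≥0∞}
    (h : ‖(((2 : ℝ) ^ y : ℝ) : ℂ) * c‖ₑ ≤ A) : ‖c‖ₑ ≤ (2 : ℝ≥0∞) ^ (-y) * A := by
  rw [enorm_two_rpow_mul] at h
  calc ‖c‖ₑ = (2 : ℝ≥0∞) ^ (-y) * ((2 : ℝ≥0∞) ^ y * ‖c‖ₑ) := by
        rw [← mul_assoc, ← two_rpow_add]; simp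
    _ ≤ _ := mul_le_mul' le_rfl h

/-- The bound of the `j`-th piece of `φ`. -/
noncomputable def freqBound (s : ℝ) (φ : E → ℂ) (j : ℤ) : E → ℝ≥0∞ :=
  pieceBound s (fun y => ‖𝓕⁻ φ y‖ₑ) (fun y => ‖𝓕⁻ (freqPow s φ) y‖ₑ) j

theorem measurable_freqBound (s : ℝ) {φ : E → ℂ} (hφ : Integrable φ)
    (hφs : Integrable (freqPow s φ)) (j : ℤ) : Measurable (freqBound s φ j) :=
  measurable_pieceBound s (continuous_fourierInv hφ).measurable.enorm
    (continuous_fourierInv hφs).measurable.enorm j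

theorem exists_freqPiece_bounds {s : ℝ} (hs : 0 < s) : ∃ C : ℝ≥0∞, C ≠ ∞ ∧ ∀ φ : E → ℂ,
    Integrable φ → Integrable (freqPow s φ) → ∀ j : ℤ,
      (∀ x, ‖𝓕⁻ (freqPiece j φ) x‖ₑ ≤ C * freqBound s φ j x) ∧
      (∀ x w, ‖𝓕⁻ (freqPiece j φ) (x - w) - 𝓕⁻ (freqPiece j φ) x‖ₑ ≤
        C * ENNReal.ofReal ((2 ^ (j : ℝ) * ‖w‖) *
          (1 + 2 ^ (j : ℝ) * ‖w‖) ^ (Module.finrank ℝ E + 1)) * freqBound s φ j x) ∧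
      ∀ x, ‖𝓕⁻ (freqPow s (freqPiece j φ)) x‖ₑ ≤ C * (2 : ℝ≥0∞) ^ (j * s) * freqBound s φ j x := by
  obtain ⟨C₀, h₀t, h₀⟩ := exists_enorm_convolution_le (annulusKernel (E := E) 0)
  obtain ⟨C₁, h₁t, h₁⟩ := exists_enorm_convolution_le (annulusKernel (E := E) (-s))
  obtain ⟨C₂, h₂t, h₂⟩ := exists_enorm_convolution_le (annulusKernel (E := E) s)
  set C := C₀ + C₁ + C₂ with hC
  have hC0 : C₀ ≤ C := by rw [hC, add_assoc]; exact le_self_add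
  have hC1 : C₁ ≤ C := by rw [hC, add_right_comm]; exact le_add_self
  have hC2 : C₂ ≤ C := le_add_self
  refine ⟨C, by rw [hC]; finiteness, fun φ hφ hφs j => ?_⟩
  have hc := continuous_fourierInv hφ
  have hcs := continuous_fourierInv hφs
  have hb : ∃ B, ∀ y, ‖𝓕⁻ φ y‖ ≤ B := ⟨_, norm_fourierInv_le φ⟩
  have hbs : ∃ B, ∀ y, ‖𝓕⁻ (freqPow s φ) y‖ ≤ B := ⟨_, norm_fourierInv_le _⟩
  obtain ⟨a₀, b₀⟩ := h₀ _ _ j hc hb (fourierInv_freqPiece hφ j)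
  obtain ⟨a₁, b₁⟩ := h₁ _ _ j hcs hbs (two_rpow_mul_fourierInv_freqPiece hs hφs j)
  obtain ⟨a₂, -⟩ := h₂ _ _ j hc hb fun x => rfl
  obtain ⟨a₃, -⟩ := h₀ _ _ j hcs hbs (fourierInv_freqPiece hφs j)
  refine ⟨fun x => ?_, fun x w => ?_, fun x => ?_⟩
  · rw [freqBound, pieceBound, mul_min]
    refine le_min ((a₀ x).trans (mul_le_mul' hC0 le_rfl)) ?_
    refine (enorm_le_of_two_rpow_mul (a₁ x)).trans ?_
    rw [mul_left_comm]
    exact mul_le_mul' hC1 le_rfl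
  · rw [freqBound, pieceBound, mul_min]
    refine le_min ((b₀ x w).trans (mul_le_mul' (mul_le_mul' hC0 le_rfl) le_rfl)) ?_
    have := b₁ x w
    rw [← mul_sub] at this
    refine (enorm_le_of_two_rpow_mul this).trans ?_
    rw [mul_left_comm]
    exact mul_le_mul' (mul_le_mul' hC1 le_rfl) le_rfl
  · rw [freqBound, pieceBound, mul_min]
    refine le_min ?_ ?_
    · rw [fourierInv_freqPow_freqPiece s hφ, enorm_two_rpow_mul, mul_comm C, mul_assoc]
      exact mul_le_mul' le_rfl ((a₂ x).trans (mul_le_mul' hC2 le_rfl))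
    · rw [freqPow_freqPiece]
      refine (a₃ x).trans ?_
      rw [← mul_assoc, mul_assoc C, ← two_rpow_add]
      simp only [add_neg_cancel, ENNReal.rpow_zero, mul_one]
      exact mul_le_mul' hC0 le_rfl

end Pieces

section Series

variable {X : Type*} [MeasurableSpace X] {μ : Measure X} {ι : Type*} [Countable ι]

theorem enorm_integral_le_tsum {f : ι → X → ℂ} {g : X → ℂ}
    (hf : ∀ i, AEStronglyMeasurable (f i) μ) (hfin : ∑' i, ∫⁻ x, ‖f i x‖ₑ ∂μ ≠ ∞)
    (hsum : ∀ x, HasSum (fun i => f i x) (g x)) :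
    ‖∫ x, g x ∂μ‖ₑ ≤ ∑' i, ‖∫ x, f i x ∂μ‖ₑ := by
  have : ∫ x, g x ∂μ = ∑' i, ∫ x, f i x ∂μ := by
    rw [← integral_tsum hf hfin]
    congr 1; ext x
    exact (hsum x).tsum_eq.symm
  rw [this]
  exact enorm_tsum_le_tsum_enorm

theorem hasSum_weight_mul {w : ι → X → ℝ} {A : X → ℂ}
    (hw : ∀ x, A x ≠ 0 → HasSum (fun i => w i x) 1) (x : X) :
    HasSum (fun i => (w i x : ℂ) * A x) (A x) := by
  by_cases hA : A x = 0
  · simp [hA]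
  · simpa using ((Complex.hasSum_ofReal.2 (hw x hA)).mul_right (A x))

theorem tsum_lintegral_enorm_weight_mul_ne_top {w : ι → X → ℝ} {A : X → ℂ} (hA : Integrable A μ)
    (hwm : ∀ i, Measurable (w i)) (hw0 : ∀ i x, 0 ≤ w i x)
    (hw : ∀ x, A x ≠ 0 → HasSum (fun i => w i x) 1) :
    ∑' i, ∫⁻ x, ‖(w i x : ℂ) * A x‖ₑ ∂μ ≠ ∞ := by
  have hm : ∀ i, AEStronglyMeasurable (fun x => (w i x : ℂ) * A x) μ := fun i =>
    (Complex.measurable_ofReal.comp (hwm i)).aestronglyMeasurable.mul hA.1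
  rw [← lintegral_tsum fun i => (hm i).enorm]
  refine ne_of_lt (lt_of_le_of_lt (lintegral_mono fun x => ?_) hA.2)
  by_cases h : A x = 0
  · simp [h]
  · have h1 := hw x h
    have h2 : ∑' i, ‖(w i x : ℂ)‖ₑ = 1 := by
      have : ∀ i, ‖(w i x : ℂ)‖ₑ = ENNReal.ofReal (w i x) := fun i => by
        rw [← ofReal_norm, Complex.norm_real, Real.norm_of_nonneg (hw0 i x)]
      simp_rw [this]
      rw [← ENNReal.ofReal_tsum_of_nonneg (fun i => hw0 i x) h1.summable, h1.tsum_eq,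
        ENNReal.ofReal_one]
    simp_rw [enorm_mul]
    rw [ENNReal.tsum_mul_right, h2, one_mul]

theorem enorm_integral_sub_le_tsum {w w' : ι → X → ℝ} {A B : X → ℂ} (hA : Integrable A μ)
    (hB : Integrable B μ) (hwm : ∀ i, Measurable (w i)) (hw0 : ∀ i x, 0 ≤ w i x)
    (hw : ∀ x, A x ≠ 0 → HasSum (fun i => w i x) 1)
    (hwm' : ∀ i, Measurable (w' i)) (hw0' : ∀ i x, 0 ≤ w' i x)
    (hw' : ∀ x, B x ≠ 0 → HasSum (fun i => w' i x) 1) :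
    ‖∫ x, (A x - B x) ∂μ‖ₑ ≤ ∑' i, ‖∫ x, ((w i x : ℂ) * A x - (w' i x : ℂ) * B x) ∂μ‖ₑ := by
  have mA : ∀ i, AEStronglyMeasurable (fun x => (w i x : ℂ) * A x) μ := fun i =>
    (Complex.measurable_ofReal.comp (hwm i)).aestronglyMeasurable.mul hA.1
  have mB : ∀ i, AEStronglyMeasurable (fun x => (w' i x : ℂ) * B x) μ := fun i =>
    (Complex.measurable_ofReal.comp (hwm' i)).aestronglyMeasurable.mul hB.1
  refine enorm_integral_le_tsum (fun i => (mA i).sub (mB i)) (ne_of_lt ?_)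
    fun x => (hasSum_weight_mul hw x).sub (hasSum_weight_mul hw' x)
  calc ∑' i, ∫⁻ x, ‖(w i x : ℂ) * A x - (w' i x : ℂ) * B x‖ₑ ∂μ
      ≤ ∑' i, (∫⁻ x, ‖(w i x : ℂ) * A x‖ₑ ∂μ + ∫⁻ x, ‖(w' i x : ℂ) * B x‖ₑ ∂μ) := by
        refine ENNReal.tsum_le_tsum fun i => ?_
        rw [← lintegral_add_left' (mA i).enorm]
        exact lintegral_mono fun x => enorm_sub_le
    _ < ∞ := by
        rw [ENNReal.tsum_add]
        exact ENNReal.add_lt_top.2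
          ⟨(tsum_lintegral_enorm_weight_mul_ne_top hA hwm hw0 hw).lt_top,
            (tsum_lintegral_enorm_weight_mul_ne_top hB hwm' hw0' hw').lt_top⟩

theorem enorm_integral_le_tsum_weight {w : ι → X → ℝ} {A : X → ℂ} (hA : Integrable A μ)
    (hwm : ∀ i, Measurable (w i)) (hw0 : ∀ i x, 0 ≤ w i x)
    (hw : ∀ x, A x ≠ 0 → HasSum (fun i => w i x) 1) :
    ‖∫ x, A x ∂μ‖ₑ ≤ ∑' i, ‖∫ x, (w i x : ℂ) * A x ∂μ‖ₑ := by
  refine enorm_integral_le_tsum (fun i =>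
    (Complex.measurable_ofReal.comp (hwm i)).aestronglyMeasurable.mul hA.1)
    (tsum_lintegral_enorm_weight_mul_ne_top hA hwm hw0 hw) (hasSum_weight_mul hw)

end Series

section Commutator

variable {E : Type*} [NormedAddCommGroup E] [InnerProductSpace ℝ E] [FiniteDimensional ℝ E]
  [MeasurableSpace E] [BorelSpace E]

theorem exists_enorm_commutator_le (κ : 𝓢(E, ℂ)) : ∃ C : ℝ≥0∞, C ≠ ∞ ∧
    ∀ (f g : E → ℂ) (F G : E → ℝ≥0∞) (j l : ℤ), Measurable F → Measurable G →
      (∀ x, ‖f x‖ₑ ≤ F x) → (∀ x, ‖g x‖ₑ ≤ G x) →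
      (∀ x w, ‖f (x - w) - f x‖ₑ ≤ ENNReal.ofReal ((2 ^ (j : ℝ) * ‖w‖) *
        (1 + 2 ^ (j : ℝ) * ‖w‖) ^ (Module.finrank ℝ E + 1)) * F x) →
      ∀ x, ‖∫ z, κ z * ((f (x - (2 : ℝ) ^ (-(l : ℝ)) • z) - f x) *
          g (x - (2 : ℝ) ^ (-(l : ℝ)) • z))‖ₑ
        ≤ C * (2 : ℝ≥0∞) ^ (((j : ℝ) - l) / 2) * maxProd F G x := by
  obtain ⟨C, hC0, hC⟩ := exists_one_add_norm_pow_mul_norm_le κ (Module.finrank ℝ E + 2)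
  have hC' : ∀ z, ‖κ z‖ₑ ≤ ENNReal.ofReal C * ENNReal.ofReal (decayWeight z) := by
    intro z
    rw [← ENNReal.ofReal_mul hC0, ← ofReal_norm]
    refine ENNReal.ofReal_le_ofReal (le_trans ?_ (hC z))
    exact le_mul_of_one_le_left (norm_nonneg _) (one_le_pow₀ (by linarith [norm_nonneg z]))
  have hwm := (continuous_decayWeight (E := E)).measurable
  refine ⟨ENNReal.ofReal C, by finiteness, fun f g F G j l hF hG hf hg hfd x => ?_⟩
  refine (enorm_integral_le_lintegral_enorm _).trans ?_
  simp_rw [enorm_mul]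
  set t : ℝ := (2 : ℝ) ^ (-(l : ℝ)) with ht
  have ht0 : 0 < t := by positivity
  rcases le_or_gt j l with hjl | hjl
  · have hjl' : (j : ℝ) - l ≤ 0 := by
      have : (j : ℝ) ≤ l := by exact_mod_cast hjl
      linarith
    have h2 : (2 : ℝ) ^ (j : ℝ) * t = 2 ^ ((j : ℝ) - l) := by
      rw [ht, ← Real.rpow_add two_pos, sub_eq_add_neg]
    have h21 : (2 : ℝ) ^ ((j : ℝ) - l) ≤ 1 := Real.rpow_le_one_of_one_le_of_nonpos one_le_two hjl'
    have pt : ∀ z, ‖κ z‖ₑ * ‖f (x - t • z) - f x‖ₑ ≤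
        ENNReal.ofReal C * (2 : ℝ≥0∞) ^ ((j : ℝ) - l) * F x * ENNReal.ofReal (decayWeight z) := by
      intro z
      refine (mul_le_mul' le_rfl (hfd x (t • z))).trans ?_
      rw [← ofReal_norm, ← mul_assoc, ← ENNReal.ofReal_mul (norm_nonneg _)]
      have : ‖κ z‖ * (2 ^ (j : ℝ) * ‖t • z‖ * (1 + 2 ^ (j : ℝ) * ‖t • z‖) ^
          (Module.finrank ℝ E + 1)) ≤ C * 2 ^ ((j : ℝ) - l) * decayWeight z := by
        have e : (2 : ℝ) ^ (j : ℝ) * (t * ‖z‖) = 2 ^ ((j : ℝ) - l) * ‖z‖ := by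
          rw [← mul_assoc, h2]
        rw [norm_smul, Real.norm_of_nonneg ht0.le, e]
        set b := (2 : ℝ) ^ ((j : ℝ) - l)
        have hb0 : 0 ≤ b := by positivity
        have h3 : b * ‖z‖ ≤ ‖z‖ := mul_le_of_le_one_left (norm_nonneg _) h21
        calc ‖κ z‖ * (b * ‖z‖ * (1 + b * ‖z‖) ^ (Module.finrank ℝ E + 1))
            ≤ ‖κ z‖ * (b * (1 + ‖z‖) * (1 + ‖z‖) ^ (Module.finrank ℝ E + 1)) := by
              gcongr; linarith
          _ = b * ((1 + ‖z‖) ^ (Module.finrank ℝ E + 2) * ‖κ z‖) := by ring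
          _ ≤ b * (C * decayWeight z) := mul_le_mul_of_nonneg_left (hC z) hb0
          _ = _ := by ring
      refine (mul_le_mul' (ENNReal.ofReal_le_ofReal this) le_rfl).trans (le_of_eq ?_)
      rw [ENNReal.ofReal_mul (by positivity), ENNReal.ofReal_mul hC0, ofReal_two_rpow]
      ring
    calc _ ≤ ∫⁻ z, ENNReal.ofReal C * (2 : ℝ≥0∞) ^ ((j : ℝ) - l) * F x *
          (ENNReal.ofReal (decayWeight z) * G (x - t • z)) := by
          refine lintegral_mono fun z => ?_
          rw [← mul_assoc, ← mul_assoc]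
          exact mul_le_mul' (pt z) (hg _)
      _ = ENNReal.ofReal C * (2 : ℝ≥0∞) ^ ((j : ℝ) - l) * F x *
          ∫⁻ z, (ENNReal.ofReal (decayWeight z) * G (x - t • z)) :=
          lintegral_const_mul _ (by fun_prop)
      _ ≤ ENNReal.ofReal C * (2 : ℝ≥0∞) ^ (((j : ℝ) - l) / 2) * F x * dyadicMax G x := by
          refine mul_le_mul' (mul_le_mul' (mul_le_mul' le_rfl (two_rpow_mono ?_)) le_rfl)
            (lintegral_decayWeight_le_dyadicMax G l x)
          linarith
      _ ≤ _ := by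
          rw [mul_assoc]
          exact mul_le_mul' le_rfl (le_add_self.trans le_self_add)
  · have hjl' : 0 ≤ ((j : ℝ) - l) / 2 := by
      have : (l : ℝ) ≤ j := by exact_mod_cast hjl.le
      linarith
    calc _ ≤ ∫⁻ z, ENNReal.ofReal C * (F x * (ENNReal.ofReal (decayWeight z) * G (x - t • z)) +
          ENNReal.ofReal (decayWeight z) * (F (x - t • z) * G (x - t • z))) := by
          refine lintegral_mono fun z => ?_
          calc _ ≤ (ENNReal.ofReal C * ENNReal.ofReal (decayWeight z)) *
                ((F (x - t • z) + F x) * G (x - t • z)) := by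
                refine mul_le_mul' (hC' z) (mul_le_mul' ?_ (hg _))
                exact enorm_sub_le.trans (add_le_add (hf _) (hf _))
            _ = _ := by ring
      _ = ENNReal.ofReal C * ((F x * ∫⁻ z, ENNReal.ofReal (decayWeight z) * G (x - t • z)) +
          ∫⁻ z, ENNReal.ofReal (decayWeight z) * (F (x - t • z) * G (x - t • z))) := by
          rw [lintegral_const_mul _ (by fun_prop), lintegral_add_left (by fun_prop),
            lintegral_const_mul _ (by fun_prop)]
      _ ≤ ENNReal.ofReal C * (F x * dyadicMax G x + dyadicMax (fun y => F y * G y) x) := by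
          refine mul_le_mul' le_rfl (add_le_add (mul_le_mul' le_rfl ?_) ?_)
          · exact lintegral_decayWeight_le_dyadicMax G l x
          · exact lintegral_decayWeight_le_dyadicMax (fun y => F y * G y) l x
      _ ≤ ENNReal.ofReal C * (2 : ℝ≥0∞) ^ (((j : ℝ) - l) / 2) * maxProd F G x := by
          refine mul_le_mul' (le_mul_of_one_le_right' ?_) ?_
          · simpa using two_rpow_mono hjl'
          · unfold maxProd; rw [add_assoc]; exact le_add_self

end Commutator

section Bilinear

variable {E : Type*} [NormedAddCommGroup E] [InnerProductSpace ℝ E] [FiniteDimensional ℝ E]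
  [MeasurableSpace E] [BorelSpace E]

/-- The frequency integrand of the product of two functions with spectra `φ` and `γ`. -/
noncomputable def prodWave (φ γ : E → ℂ) (x : E) (p : E × E) : ℂ :=
  φ p.1 * γ p.2 * wave x (p.1 + p.2)

theorem integrable_prodWave {φ γ : E → ℂ} (hφ : Integrable φ) (hγ : Integrable γ) (x : E) :
    Integrable (prodWave φ γ x) (volume.prod volume) := by
  have h2 : Measurable fun p : E × E => wave x (p.1 + p.2) :=
    measurable_wave_comp (by fun_prop) (by fun_prop)
  exact (hφ.mul_prod hγ).mul_bdd (c := 1) h2.aestronglyMeasurable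
    (ae_of_all _ fun p => (norm_wave _ _).le)

theorem integral_prodWave (φ γ : E → ℂ) (x : E) :
    ∫ p, prodWave φ γ x p ∂(volume.prod volume) = 𝓕⁻ φ x * 𝓕⁻ γ x := by
  rw [fourierInv_eq_wave, fourierInv_eq_wave, ← integral_prod_mul]
  congr 1; ext p
  rw [prodWave, wave_add_right]; ring

theorem norm_fst_rpow_mul_prodWave (s : ℝ) (φ γ : E → ℂ) (x : E) (p : E × E) :
    ((‖p.1‖ ^ s : ℝ) : ℂ) * prodWave φ γ x p = prodWave (freqPow s φ) γ x p := by
  simp only [prodWave, freqPow]; ring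

theorem norm_snd_rpow_mul_prodWave (s : ℝ) (φ γ : E → ℂ) (x : E) (p : E × E) :
    ((‖p.2‖ ^ s : ℝ) : ℂ) * prodWave φ γ x p = prodWave φ (freqPow s γ) x p := by
  simp only [prodWave, freqPow]; ring

theorem norm_add_rpow_le {s : ℝ} (hs : 0 ≤ s) (ξ η : E) :
    ‖ξ + η‖ ^ s ≤ 2 ^ s * (‖ξ‖ ^ s + ‖η‖ ^ s) := by
  have h1 : ‖ξ + η‖ ≤ 2 * max ‖ξ‖ ‖η‖ := by
    linarith [norm_add_le ξ η, le_max_left ‖ξ‖ ‖η‖, le_max_right ‖ξ‖ ‖η‖]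
  have a : 0 ≤ ‖ξ‖ ^ s := by positivity
  have b : 0 ≤ ‖η‖ ^ s := by positivity
  calc ‖ξ + η‖ ^ s ≤ (2 * max ‖ξ‖ ‖η‖) ^ s := Real.rpow_le_rpow (norm_nonneg _) h1 hs
    _ = 2 ^ s * (max ‖ξ‖ ‖η‖) ^ s := Real.mul_rpow two_pos.le (by positivity)
    _ ≤ _ := by
      refine mul_le_mul_of_nonneg_left ?_ (by positivity)
      rcases max_choice ‖ξ‖ ‖η‖ with h | h <;> rw [h] <;> linarith

theorem measurable_norm_rpow_ofReal (s : ℝ) {X : Type*} [MeasurableSpace X] {L : X → E}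
    (hL : Measurable L) : Measurable fun p => ((‖L p‖ ^ s : ℝ) : ℂ) :=
  Complex.measurable_ofReal.comp (hL.norm.pow_const s)

theorem integrable_norm_add_rpow_mul_prodWave {s : ℝ} (hs : 0 ≤ s) {φ γ : E → ℂ}
    (hφ : Integrable φ) (hφs : Integrable (freqPow s φ)) (hγ : Integrable γ)
    (hγs : Integrable (freqPow s γ)) (x : E) :
    Integrable (fun p : E × E => ((‖p.1 + p.2‖ ^ s : ℝ) : ℂ) * prodWave φ γ x p)
      (volume.prod volume) := by
  refine (((integrable_prodWave hφs hγ x).norm.add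
    (integrable_prodWave hφ hγs x).norm).const_mul (2 ^ s)).mono'
    ((measurable_norm_rpow_ofReal s (by fun_prop)).aestronglyMeasurable.mul
      (integrable_prodWave hφ hγ x).1) (ae_of_all _ fun p => ?_)
  simp only [Pi.add_apply]
  rw [← norm_fst_rpow_mul_prodWave, ← norm_snd_rpow_mul_prodWave]
  simp only [norm_mul, Complex.norm_real]
  rw [Real.norm_of_nonneg (by positivity), Real.norm_of_nonneg (by positivity),
    Real.norm_of_nonneg (by positivity), ← add_mul, ← mul_assoc]
  exact mul_le_mul_of_nonneg_right (norm_add_rpow_le hs _ _) (norm_nonneg _)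

theorem integral_dyadic_add_mul_prodWave (s : ℝ) {φ γ : E → ℂ} (hφ : Integrable φ)
    (hγ : Integrable γ) (l : ℤ) (x : E) :
    ∫ p : E × E, (dyadicBump l (p.1 + p.2) : ℂ) * (((‖p.1 + p.2‖ ^ s : ℝ) : ℂ) *
        prodWave φ γ x p) ∂(volume.prod volume)
      = (((2 : ℝ) ^ (l * s) : ℝ) : ℂ) * ∫ z, annulusKernel s z *
        (𝓕⁻ φ (x - (2 : ℝ) ^ (-(l : ℝ)) • z) * 𝓕⁻ γ (x - (2 : ℝ) ^ (-(l : ℝ)) • z)) := by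
  simp_rw [← integral_prodWave]
  have := integral_fourier_smul_mul_wave (annulusKernel (E := E) s).integrable
    (L := fun p : E × E => p.1 + p.2) (by fun_prop) (hφ.mul_prod hγ) ((2 : ℝ) ^ (-(l : ℝ))) x
  simp only [fourier_annulusKernel] at this
  unfold prodWave
  rw [← this, ← integral_const_mul]
  congr 1; ext p
  rw [← mul_assoc _ (annulusPow _ _), annulusPow_two_rpow_smul]
  push_cast; ring

theorem integral_dyadic_snd_mul_prodWave (s : ℝ) (φ : E → ℂ) {γ : E → ℂ}
    (hγ : Integrable γ) (l : ℤ) (x : E) :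
    ∫ p : E × E, (dyadicBump l p.2 : ℂ) * (((‖p.2‖ ^ s : ℝ) : ℂ) *
        prodWave φ γ x p) ∂(volume.prod volume)
      = (((2 : ℝ) ^ (l * s) : ℝ) : ℂ) * ∫ z, annulusKernel s z *
        (𝓕⁻ φ x * 𝓕⁻ γ (x - (2 : ℝ) ^ (-(l : ℝ)) • z)) := by
  simp_rw [mul_left_comm _ (𝓕⁻ φ x), integral_const_mul, mul_left_comm _ (𝓕⁻ φ x)]
  rw [← fourierInv_freqPow_freqPiece s hγ, freqPow_freqPiece, ← integral_prodWave]
  congr 1; ext p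
  simp only [prodWave, freqPow, freqPiece]; ring

theorem integral_dyadic_sub_mul_prodWave {s : ℝ} (hs : 0 ≤ s) {φ γ : E → ℂ} (hφ : Integrable φ)
    (hφs : Integrable (freqPow s φ)) (hγ : Integrable γ) (hγs : Integrable (freqPow s γ))
    (l : ℤ) (x : E) :
    ∫ p : E × E, ((dyadicBump l (p.1 + p.2) : ℂ) * (((‖p.1 + p.2‖ ^ s : ℝ) : ℂ) *
        prodWave φ γ x p) - (dyadicBump l p.2 : ℂ) * (((‖p.2‖ ^ s : ℝ) : ℂ) *
        prodWave φ γ x p)) ∂(volume.prod volume)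
      = (((2 : ℝ) ^ (l * s) : ℝ) : ℂ) * ∫ z, annulusKernel s z *
        ((𝓕⁻ φ (x - (2 : ℝ) ^ (-(l : ℝ)) • z) - 𝓕⁻ φ x) *
          𝓕⁻ γ (x - (2 : ℝ) ^ (-(l : ℝ)) • z)) := by
  have hm : ∀ (L : E × E → E), Measurable L → ∀ h : E × E → ℂ,
      Integrable h (volume.prod volume) →
      Integrable (fun p => (dyadicBump l (L p) : ℂ) * h p) (volume.prod volume) :=
    fun L hL h hh => hh.bdd_mul ((measurable_dyadicBump_ofReal l).comp hL).aestronglyMeasurable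
      (ae_of_all _ fun p => norm_dyadicBump_le_one l (L p))
  have hB : Integrable (fun p : E × E => ((‖p.2‖ ^ s : ℝ) : ℂ) * prodWave φ γ x p)
      (volume.prod volume) := by
    simp_rw [norm_snd_rpow_mul_prodWave]; exact integrable_prodWave hφ hγs x
  rw [integral_sub (hm _ (by fun_prop) _
      (integrable_norm_add_rpow_mul_prodWave hs hφ hφs hγ hγs x)) (hm _ (by fun_prop) _ hB),
    integral_dyadic_add_mul_prodWave s hφ hγ, integral_dyadic_snd_mul_prodWave s φ hγ,
    ← mul_sub, ← integral_sub]
  · congr 2; ext z; ring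
  all_goals
    have c1 := continuous_fourierInv hφ
    have c2 := continuous_fourierInv hγ
    refine (annulusKernel (E := E) s).integrable.mul_bdd
      (c := (∫ ξ, ‖φ ξ‖) * ∫ ξ, ‖γ ξ‖) (Continuous.aestronglyMeasurable (by fun_prop))
      (ae_of_all _ fun z => ?_)
    rw [norm_mul]
    exact mul_le_mul (norm_fourierInv_le _ _) (norm_fourierInv_le _ _) (norm_nonneg _)
      (by positivity)

/-- The symbol of `(u, v) ↦ Λ^s (u v) - u Λ^s v - v Λ^s u`. -/
noncomputable def leibnizSymbol (s : ℝ) (p : E × E) : ℝ :=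
  ‖p.1 + p.2‖ ^ s - ‖p.1‖ ^ s - ‖p.2‖ ^ s

theorem freqPiece_eq_zero_of_ge {j : ℤ} {ξ : E} (φ : E → ℂ) (h : (2 : ℝ) ^ ((j : ℝ) + 1) ≤ ‖ξ‖) :
    freqPiece j φ ξ = 0 := by
  rw [freqPiece, dyadicBump_eq_zero_of_ge h]; simp

theorem dyadic_add_mul_prodWave_eq_zero {j k l : ℤ} (hjk : j ≤ k) (hkl : k + 2 < l)
    (φ γ : E → ℂ) (x : E) (p : E × E) :
    (dyadicBump l (p.1 + p.2) : ℂ) * prodWave (freqPiece j φ) (freqPiece k γ) x p = 0 ∧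
    (dyadicBump l p.2 : ℂ) * prodWave (freqPiece j φ) (freqPiece k γ) x p = 0 := by
  have hjk' : (j : ℝ) ≤ k := by exact_mod_cast hjk
  have hkl' : (k : ℝ) + 3 ≤ l := by
    have : k + 3 ≤ l := by omega
    exact_mod_cast this
  rcases le_or_gt ((2 : ℝ) ^ ((j : ℝ) + 1)) ‖p.1‖ with h1 | h1
  · simp [prodWave, freqPiece_eq_zero_of_ge φ h1]
  rcases le_or_gt ((2 : ℝ) ^ ((k : ℝ) + 1)) ‖p.2‖ with h2 | h2
  · simp [prodWave, freqPiece_eq_zero_of_ge γ h2]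
  have e1 : (2 : ℝ) ^ ((j : ℝ) + 1) ≤ 2 ^ ((k : ℝ) + 1) :=
    Real.rpow_le_rpow_of_exponent_le one_le_two (by linarith)
  have e2 : (2 : ℝ) ^ ((k : ℝ) + 2) ≤ 2 ^ ((l : ℝ) - 1) :=
    Real.rpow_le_rpow_of_exponent_le one_le_two (by linarith)
  have e3 : (2 : ℝ) ^ ((k : ℝ) + 2) = 2 * 2 ^ ((k : ℝ) + 1) := by
    rw [show (k : ℝ) + 2 = 1 + (k + 1) by ring, Real.rpow_add two_pos, Real.rpow_one]
  have e4 : (0 : ℝ) < 2 ^ ((k : ℝ) + 1) := by positivity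
  rw [dyadicBump_eq_zero_of_le (by linarith [norm_add_le p.1 p.2]),
    dyadicBump_eq_zero_of_le (by linarith)]
  simp

theorem exists_enorm_leibniz_lowHigh_le {s : ℝ} (hs : 1 ≤ s) : ∃ C : ℝ≥0∞, C ≠ ∞ ∧
    ∀ φ γ : E → ℂ, Integrable φ → Integrable (freqPow s φ) → Integrable γ →
      Integrable (freqPow s γ) → ∀ (k : ℤ) (i : ℕ) (x : E),
      ‖∫ p : E × E, (leibnizSymbol s p : ℂ) *
          prodWave (freqPiece (k - i) φ) (freqPiece k γ) x p ∂(volume.prod volume)‖ₑ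
        ≤ C * ((2 : ℝ≥0∞) ^ (k * s - i / 2) *
          maxProd (freqBound s φ (k - i)) (freqBound s γ k) x) := by
  have hs0 : 0 < s := by linarith
  obtain ⟨C₁, hC₁, h₁⟩ := exists_freqPiece_bounds (E := E) hs0
  obtain ⟨C₂, hC₂, h₂⟩ := exists_enorm_commutator_le (annulusKernel (E := E) s)
  set S : ℝ≥0∞ := ∑' i : ℕ, (2 : ℝ≥0∞) ^ (-(i * (s - 1 / 2))) with hS
  have hSt : S ≠ ∞ := tsum_two_rpow_neg_ne_top (by linarith)
  have h2t := two_rpow_ne_top (2 * (s - 1 / 2))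
  refine ⟨S * (C₂ * 2 ^ (2 * (s - 1 / 2)) * (C₁ * C₁)) + C₁ * C₁, by finiteness,
    fun φ γ hφ hφs hγ hγs k i x => ?_⟩
  set j : ℤ := k - i with hj
  have hjr : (j : ℝ) = k - i := by rw [hj]; push_cast; ring
  have hjk : j ≤ k := by omega
  set f := freqPiece j φ with hf
  set g := freqPiece k γ with hg
  have hfi : Integrable f := integrable_freqPiece hφ j
  have hgi : Integrable g := integrable_freqPiece hγ k
  have hfs : Integrable (freqPow s f) := by
    rw [hf, freqPow_freqPiece]; exact integrable_freqPiece hφs j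
  have hgs : Integrable (freqPow s g) := by
    rw [hg, freqPow_freqPiece]; exact integrable_freqPiece hγs k
  set F := freqBound s φ j with hF
  set G := freqBound s γ k with hG
  have hFm : Measurable F := measurable_freqBound s hφ hφs j
  have hGm : Measurable G := measurable_freqBound s hγ hγs k
  obtain ⟨f1, f2, f3⟩ := h₁ φ hφ hφs j
  obtain ⟨g1, -, -⟩ := h₁ γ hγ hγs k
  set A : E × E → ℂ := fun p => ((‖p.1 + p.2‖ ^ s : ℝ) : ℂ) * prodWave f g x p with hA
  set B : E × E → ℂ := fun p => ((‖p.2‖ ^ s : ℝ) : ℂ) * prodWave f g x p with hB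
  have hAi : Integrable A (volume.prod volume) :=
    integrable_norm_add_rpow_mul_prodWave hs0.le hfi hfs hgi hgs x
  have hBi : Integrable B (volume.prod volume) := by
    rw [hB]; simp_rw [norm_snd_rpow_mul_prodWave]; exact integrable_prodWave hfi hgs x
  have hD : Integrable (prodWave (freqPow s f) g x) (volume.prod volume) :=
    integrable_prodWave hfs hgi x
  have hsplit : ∫ p : E × E, (leibnizSymbol s p : ℂ) * prodWave f g x p ∂(volume.prod volume)
      = ∫ p : E × E, (A p - B p) ∂(volume.prod volume) - 𝓕⁻ (freqPow s f) x * 𝓕⁻ g x := by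
    rw [← integral_prodWave]
    refine Eq.trans ?_ (integral_sub (hAi.sub hBi) hD)
    congr 1; ext p
    rw [← norm_fst_rpow_mul_prodWave, hA, hB, leibnizSymbol]
    push_cast; ring
  have hmax : maxProd (fun y => C₁ * F y) (fun y => C₁ * G y) x ≤ C₁ * C₁ * maxProd F G x :=
    maxProd_const_mul_le hC₁ hC₁ (fun _ => le_rfl) (fun _ => le_rfl) x
  have hlow : ‖𝓕⁻ (freqPow s f) x * 𝓕⁻ g x‖ₑ
      ≤ C₁ * C₁ * ((2 : ℝ≥0∞) ^ (k * s - i / 2) * maxProd F G x) := by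
    rw [enorm_mul]
    have : (2 : ℝ≥0∞) ^ (j * s) ≤ 2 ^ (k * s - i / 2) := by
      refine two_rpow_mono ?_
      rw [hjr]
      have : (0 : ℝ) ≤ i := Nat.cast_nonneg i
      nlinarith
    calc _ ≤ (C₁ * (2 : ℝ≥0∞) ^ (j * s) * F x) * (C₁ * G x) := mul_le_mul' (f3 x) (g1 x)
      _ = C₁ * C₁ * (2 ^ (j * s) * (F x * G x)) := by ring
      _ ≤ _ := mul_le_mul' le_rfl (mul_le_mul' this (by
        unfold maxProd; rw [add_assoc]; exact le_self_add))
  have hne : ∀ (L : E × E → E) (p : E × E), ((‖L p‖ ^ s : ℝ) : ℂ) * prodWave f g x p ≠ 0 →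
      HasSum (fun l : ℤ => dyadicBump l (L p)) 1 := by
    intro L p hp
    refine hasSum_dyadicBump fun h0 => hp ?_
    rw [h0, norm_zero, Real.zero_rpow hs0.ne']; simp
  have hmain : ‖∫ p : E × E, (A p - B p) ∂(volume.prod volume)‖ₑ ≤
      S * (C₂ * 2 ^ (2 * (s - 1 / 2)) * (C₁ * C₁)) *
        ((2 : ℝ≥0∞) ^ (k * s - i / 2) * maxProd F G x) := by
    have hwm := (continuous_dyadicBump (E := E))
    refine (enorm_integral_sub_le_tsum (w := fun (l : ℤ) p => dyadicBump l (p.1 + p.2))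
      (w' := fun (l : ℤ) p => dyadicBump l p.2) hAi hBi
      (fun l => ((hwm l).measurable).comp (by fun_prop)) (fun l p => dyadicBump_nonneg _ _)
      (hne fun p => p.1 + p.2) (fun l => ((hwm l).measurable).comp (by fun_prop))
      (fun l p => dyadicBump_nonneg _ _) (hne fun p => p.2)).trans ?_
    rw [tsum_int_le_eq (k + 2)]
    · rw [hS, mul_assoc, ← ENNReal.tsum_mul_right]
      refine ENNReal.tsum_le_tsum fun i' => ?_
      set l : ℤ := k + 2 - i' with hl
      have hlr : (l : ℝ) = k + 2 - i' := by rw [hl]; push_cast; ring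
      rw [hA, hB, integral_dyadic_sub_mul_prodWave hs0.le hfi hfs hgi hgs, enorm_two_rpow_mul]
      have := h₂ (𝓕⁻ f) (𝓕⁻ g) (fun y => C₁ * F y) (fun y => C₁ * G y) j l
        (hFm.const_mul _) (hGm.const_mul _) f1 g1
        (fun x w => (f2 x w).trans (le_of_eq (by ring))) x
      have he : (2 : ℝ≥0∞) ^ (l * s) * 2 ^ (((j : ℝ) - l) / 2) =
          2 ^ (-(i' * (s - 1 / 2))) * 2 ^ (2 * (s - 1 / 2)) * 2 ^ (k * s - i / 2) := by
        rw [← two_rpow_add, ← two_rpow_add, ← two_rpow_add, hlr, hjr]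
        congr 1; ring
      calc _ ≤ (2 : ℝ≥0∞) ^ (l * s) * (C₂ * 2 ^ (((j : ℝ) - l) / 2) *
            (C₁ * C₁ * maxProd F G x)) :=
            mul_le_mul' le_rfl (this.trans (mul_le_mul' le_rfl hmax))
        _ = (2 ^ (l * s) * 2 ^ (((j : ℝ) - l) / 2)) * (C₂ * (C₁ * C₁ * maxProd F G x)) := by ring
        _ = _ := by rw [he]; ring
    · intro l hl
      rw [enorm_eq_zero]
      refine integral_eq_zero_of_ae (ae_of_all _ fun p => ?_)
      obtain ⟨z1, z2⟩ := dyadic_add_mul_prodWave_eq_zero hjk hl φ γ x p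
      simp only [hA, hB, mul_left_comm ((dyadicBump l _ : ℝ) : ℂ), hf, hg, z1, z2, mul_zero,
        sub_zero, Pi.zero_apply]
  rw [hsplit, add_mul]
  exact enorm_sub_le.trans (add_le_add hmain hlow)

end Bilinear

section Leibniz

variable {E : Type*} [NormedAddCommGroup E] [InnerProductSpace ℝ E] [FiniteDimensional ℝ E]
  [MeasurableSpace E] [BorelSpace E]

theorem integrable_leibnizSymbol_mul_prodWave {s : ℝ} (hs : 0 ≤ s) {φ γ : E → ℂ}
    (hφ : Integrable φ) (hφs : Integrable (freqPow s φ)) (hγ : Integrable γ)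
    (hγs : Integrable (freqPow s γ)) (x : E) :
    Integrable (fun p : E × E => (leibnizSymbol s p : ℂ) * prodWave φ γ x p)
      (volume.prod volume) := by
  refine (((integrable_norm_add_rpow_mul_prodWave hs hφ hφs hγ hγs x).sub
    (integrable_prodWave hφs hγ x)).sub (integrable_prodWave hφ hγs x)).congr
    (ae_of_all _ fun p => ?_)
  simp only [Pi.sub_apply]
  rw [← norm_fst_rpow_mul_prodWave, ← norm_snd_rpow_mul_prodWave, leibnizSymbol]
  push_cast; ring

theorem integral_leibnizSymbol_mul_prodWave {s : ℝ} (hs : 0 ≤ s) {φ γ : E → ℂ}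
    (hφ : Integrable φ) (hφs : Integrable (freqPow s φ)) (hγ : Integrable γ)
    (hγs : Integrable (freqPow s γ)) (x : E) :
    ∫ p : E × E, ((‖p.1 + p.2‖ ^ s : ℝ) : ℂ) * prodWave φ γ x p ∂(volume.prod volume)
      = 𝓕⁻ (freqPow s φ) x * 𝓕⁻ γ x + 𝓕⁻ φ x * 𝓕⁻ (freqPow s γ) x +
        ∫ p : E × E, (leibnizSymbol s p : ℂ) * prodWave φ γ x p ∂(volume.prod volume) := by
  have h1 := integrable_prodWave hφs hγ x
  have h2 := integrable_prodWave hφ hγs x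
  rw [← integral_prodWave, ← integral_prodWave, ← integral_add h1 h2]
  refine Eq.trans ?_ (integral_add (h1.add h2)
    (integrable_leibnizSymbol_mul_prodWave hs hφ hφs hγ hγs x))
  congr 1; ext p
  rw [← norm_fst_rpow_mul_prodWave, ← norm_snd_rpow_mul_prodWave, leibnizSymbol]
  push_cast; ring

theorem integral_leibnizSymbol_swap (s : ℝ) (φ γ : E → ℂ) (x : E) :
    ∫ p : E × E, (leibnizSymbol s p : ℂ) * prodWave φ γ x p ∂(volume.prod volume)
      = ∫ p : E × E, (leibnizSymbol s p : ℂ) * prodWave γ φ x p ∂(volume.prod volume) := by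
  rw [← integral_prod_swap]
  congr 1; ext p
  simp only [prodWave, leibnizSymbol, Prod.fst_swap, Prod.snd_swap, add_comm p.2 p.1]
  push_cast; ring

theorem enorm_integral_leibnizSymbol_le_tsum {s : ℝ} (hs : 0 < s) {φ γ : E → ℂ}
    (hφ : Integrable φ) (hφs : Integrable (freqPow s φ)) (hγ : Integrable γ)
    (hγs : Integrable (freqPow s γ)) (x : E) :
    ‖∫ p : E × E, (leibnizSymbol s p : ℂ) * prodWave φ γ x p ∂(volume.prod volume)‖ₑ
      ≤ ∑' k : ℤ, ∑' j : ℤ, ‖∫ p : E × E, (leibnizSymbol s p : ℂ) *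
          prodWave (freqPiece j φ) (freqPiece k γ) x p ∂(volume.prod volume)‖ₑ := by
  have hm : ∀ (k : ℤ) (L : E × E → E), Measurable L → Measurable fun p => dyadicBump k (L p) :=
    fun k L hL => (continuous_dyadicBump k).measurable.comp hL
  have hA := integrable_leibnizSymbol_mul_prodWave hs.le hφ hφs hγ hγs x
  have hw : ∀ p : E × E, (leibnizSymbol s p : ℂ) * prodWave φ γ x p ≠ 0 →
      HasSum (fun k : ℤ => dyadicBump k p.2) 1 := fun p hp => hasSum_dyadicBump fun h0 => hp (by
    simp [leibnizSymbol, h0, Real.zero_rpow hs.ne'])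
  refine (enorm_integral_le_tsum_weight hA (fun k => hm k _ measurable_snd)
    (fun k p => dyadicBump_nonneg _ _) hw).trans (ENNReal.tsum_le_tsum fun k => ?_)
  have hγk : Integrable (freqPow s (freqPiece k γ)) := by
    rw [freqPow_freqPiece]; exact integrable_freqPiece hγs k
  have e1 : ∀ p, (dyadicBump k p.2 : ℂ) * ((leibnizSymbol s p : ℂ) * prodWave φ γ x p)
      = (leibnizSymbol s p : ℂ) * prodWave φ (freqPiece k γ) x p := fun p => by
    simp only [prodWave, freqPiece]; ring
  simp_rw [e1]
  have hB := integrable_leibnizSymbol_mul_prodWave hs.le hφ hφs (integrable_freqPiece hγ k) hγk x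
  have hw' : ∀ p : E × E, (leibnizSymbol s p : ℂ) * prodWave φ (freqPiece k γ) x p ≠ 0 →
      HasSum (fun j : ℤ => dyadicBump j p.1) 1 := fun p hp => hasSum_dyadicBump fun h0 => hp (by
    simp [leibnizSymbol, h0, Real.zero_rpow hs.ne'])
  refine (enorm_integral_le_tsum_weight hB (fun j => hm j _ measurable_fst)
    (fun j p => dyadicBump_nonneg _ _) hw').trans (ENNReal.tsum_le_tsum fun j => le_of_eq ?_)
  congr 2; ext p
  simp only [prodWave, freqPiece]; ring

theorem tsum_tsum_int_le (T : ℤ → ℤ → ℝ≥0∞) :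
    ∑' k, ∑' j, T j k ≤ ∑' k : ℤ, ∑' i : ℕ, T (k - i) k + ∑' k : ℤ, ∑' i : ℕ, T k (k - i) := by
  have h1 : ∀ k, ∑' i : ℕ, T (k - i) k = ∑' j, if j ≤ k then T j k else 0 := fun k => by
    rw [tsum_int_le_eq k fun j hj => if_neg hj.not_ge]
    simp
  have h2 : ∀ j, ∑' i : ℕ, T j (j - i) = ∑' k, if k ≤ j then T j k else 0 := fun j => by
    rw [tsum_int_le_eq j fun k hk => if_neg hk.not_ge]
    simp
  simp_rw [h1, h2]
  rw [ENNReal.tsum_comm (f := fun j k => if k ≤ j then T j k else 0), ← ENNReal.tsum_add]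
  refine ENNReal.tsum_le_tsum fun k => ?_
  rw [← ENNReal.tsum_add]
  refine ENNReal.tsum_le_tsum fun j => ?_
  rcases le_total j k with h | h <;> simp [h]

theorem exists_enorm_leibniz_le_paraSum {s : ℝ} (hs : 1 ≤ s) : ∃ C : ℝ≥0∞, C ≠ ∞ ∧
    ∀ φ γ : E → ℂ, Integrable φ → Integrable (freqPow s φ) → Integrable γ →
      Integrable (freqPow s γ) → ∀ x : E,
      ‖∫ p : E × E, (leibnizSymbol s p : ℂ) * prodWave φ γ x p ∂(volume.prod volume)‖ₑ
        ≤ C * (paraSum s (fun y => ‖𝓕⁻ φ y‖ₑ) (fun y => ‖𝓕⁻ (freqPow s φ) y‖ₑ)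
            (fun y => ‖𝓕⁻ γ y‖ₑ) (fun y => ‖𝓕⁻ (freqPow s γ) y‖ₑ) x +
          paraSum s (fun y => ‖𝓕⁻ γ y‖ₑ) (fun y => ‖𝓕⁻ (freqPow s γ) y‖ₑ)
            (fun y => ‖𝓕⁻ φ y‖ₑ) (fun y => ‖𝓕⁻ (freqPow s φ) y‖ₑ) x) := by
  obtain ⟨C, hC, h⟩ := exists_enorm_leibniz_lowHigh_le (E := E) hs
  refine ⟨C, hC, fun φ γ hφ hφs hγ hγs x => ?_⟩
  refine (enorm_integral_leibnizSymbol_le_tsum (by linarith) hφ hφs hγ hγs x).trans ?_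
  refine (tsum_tsum_int_le _).trans ?_
  rw [mul_add]
  simp only [paraSum, ← ENNReal.tsum_mul_left]
  refine add_le_add (ENNReal.tsum_le_tsum fun k => ENNReal.tsum_le_tsum fun i =>
      h φ γ hφ hφs hγ hγs k i x)
    (ENNReal.tsum_le_tsum fun k => ENNReal.tsum_le_tsum fun i => ?_)
  rw [integral_leibnizSymbol_swap]
  exact h γ φ hγ hγs hφ hφs k i x

end Leibniz

section Spectrum

variable {E : Type*} [NormedAddCommGroup E] [InnerProductSpace ℝ E] [FiniteDimensional ℝ E]
  [MeasurableSpace E] [BorelSpace E]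

theorem integral_comp_add_mul_prod {W φ γ : E → ℂ}
    (h : Integrable (fun p : E × E => W (p.1 + p.2) * (φ p.1 * γ p.2)) (volume.prod volume)) :
    ∫ p : E × E, W (p.1 + p.2) * (φ p.1 * γ p.2) ∂(volume.prod volume)
      = ∫ ζ, W ζ * ∫ ξ, φ ξ * γ (ζ - ξ) := by
  have hmp := measurePreserving_prod_sub (volume : Measure E) (volume : Measure E)
  have hemb : MeasurableEmbedding fun z : E × E => (z.1, z.2 - z.1) := by
    have e : (fun z : E × E => (z.1, z.2 - z.1)) = ⇑(MeasurableEquiv.shearAddRight E).symm := by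
      ext z <;> simp [MeasurableEquiv.shearAddRight, sub_eq_add_neg, add_comm]
    rw [e]
    exact (MeasurableEquiv.shearAddRight E).symm.measurableEmbedding
  rw [← hmp.integral_comp hemb]
  refine (integral_prod_symm _ ((hmp.integrable_comp_emb hemb).2 h)).trans ?_
  congr 1; ext ζ
  rw [← integral_const_mul]
  simp

theorem integral_comp_add_mul_prodWave {W φ γ : E → ℂ} (x : E)
    (h : Integrable (fun p : E × E => W (p.1 + p.2) * prodWave φ γ x p) (volume.prod volume)) :
    ∫ p : E × E, W (p.1 + p.2) * prodWave φ γ x p ∂(volume.prod volume)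
      = 𝓕⁻ (fun ζ => W ζ * ∫ ξ, φ ξ * γ (ζ - ξ)) x := by
  have e : (fun p : E × E => W (p.1 + p.2) * prodWave φ γ x p)
      = fun p => (W (p.1 + p.2) * wave x (p.1 + p.2)) * (φ p.1 * γ p.2) := by
    ext p; simp only [prodWave]; ring
  rw [e] at h ⊢
  refine (integral_comp_add_mul_prod (W := fun ζ => W ζ * wave x ζ) h).trans ?_
  rw [fourierInv_eq_wave]
  congr 1; ext ζ
  ring

theorem fourierInv_convolution {φ γ : E → ℂ} (hφ : Integrable φ) (hγ : Integrable γ) (x : E) :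
    𝓕⁻ (fun ζ => ∫ ξ, φ ξ * γ (ζ - ξ)) x = 𝓕⁻ φ x * 𝓕⁻ γ x := by
  have h := integrable_prodWave hφ hγ x
  have := integral_comp_add_mul_prodWave (W := fun _ => 1) (φ := φ) (γ := γ) x (by simpa using h)
  simpa [integral_prodWave] using this.symm

theorem integrable_freqPow_schwartz {s : ℝ} (hs : 0 ≤ s) (f : 𝓢(E, ℂ)) :
    Integrable (freqPow s f) := by
  obtain ⟨n, hn⟩ := exists_nat_ge s
  refine (f.integrable.norm.add (f.integrable_pow_mul volume n)).mono'
    ((measurable_norm_rpow_ofReal s measurable_id).aestronglyMeasurable.mul f.integrable.1)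
    (ae_of_all _ fun ξ => ?_)
  rw [freqPow, norm_mul, Complex.norm_real, Real.norm_of_nonneg (by positivity), Pi.add_apply,
    ← one_add_mul]
  refine mul_le_mul_of_nonneg_right ?_ (norm_nonneg _)
  rcases le_total ‖ξ‖ 1 with h | h
  · exact (Real.rpow_le_one (norm_nonneg _) h hs).trans (le_add_of_nonneg_right (by positivity))
  · rw [← Real.rpow_natCast]
    exact (Real.rpow_le_rpow_of_exponent_le h hn).trans (le_add_of_nonneg_left zero_le_one)

theorem fourierInv_fourier_schwartz (u : 𝓢(E, ℂ)) (x : E) : 𝓕⁻ (𝓕 (⇑u)) x = u x := by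
  rw [← SchwartzMap.fourier_coe, ← SchwartzMap.fourierInv_coe]
  simp

theorem integrable_fourier_schwartz (u : 𝓢(E, ℂ)) : Integrable (𝓕 (⇑u)) := by
  rw [← SchwartzMap.fourier_coe]; exact (𝓕 u).integrable

theorem integrable_freqPow_fourier_schwartz {s : ℝ} (hs : 0 ≤ s) (u : 𝓢(E, ℂ)) :
    Integrable (freqPow s (𝓕 (⇑u))) := by
  rw [← SchwartzMap.fourier_coe]; exact integrable_freqPow_schwartz hs _

theorem fourier_mul_eq (u v : 𝓢(E, ℂ)) (ζ : E) :
    𝓕 (fun y => u y * v y) ζ = ∫ ξ, 𝓕 (⇑u) ξ * 𝓕 (⇑v) (ζ - ξ) := by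
  set h : 𝓢(E, ℂ) := convolution (ContinuousLinearMap.mul ℂ ℂ) (𝓕 u) (𝓕 v) with hh
  have hc : ∀ ξ, h ξ = ∫ t, 𝓕 (⇑u) t * 𝓕 (⇑v) (ξ - t) := fun ξ => by
    rw [hh, convolution_apply, SchwartzMap.fourier_coe, SchwartzMap.fourier_coe]
    rfl
  have hinv : (fun y => u y * v y) = ⇑(𝓕⁻ h : 𝓢(E, ℂ)) := by
    ext y
    rw [SchwartzMap.fourierInv_coe, funext hc, fourierInv_convolution
      (integrable_fourier_schwartz u) (integrable_fourier_schwartz v),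
      fourierInv_fourier_schwartz, fourierInv_fourier_schwartz]
  rw [← hc, hinv, ← SchwartzMap.fourier_coe, FourierTransform.fourier_fourierInv_eq]

theorem fourierInv_freqPow_fourier_mul {s : ℝ} (hs : 0 ≤ s) (u v : 𝓢(E, ℂ)) (x : E) :
    𝓕⁻ (freqPow s (𝓕 fun y => u y * v y)) x
      = 𝓕⁻ (freqPow s (𝓕 ⇑u)) x * v x + u x * 𝓕⁻ (freqPow s (𝓕 ⇑v)) x +
        ∫ p : E × E, (leibnizSymbol s p : ℂ) * prodWave (𝓕 ⇑u) (𝓕 ⇑v) x p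
          ∂(volume.prod volume) := by
  have hφ := integrable_fourier_schwartz u
  have hγ := integrable_fourier_schwartz v
  have hφs := integrable_freqPow_fourier_schwartz hs u
  have hγs := integrable_freqPow_fourier_schwartz hs v
  have hi := integrable_norm_add_rpow_mul_prodWave hs hφ hφs hγ hγs x
  have key := integral_leibnizSymbol_mul_prodWave hs hφ hφs hγ hγs x
  rw [fourierInv_fourier_schwartz, fourierInv_fourier_schwartz,
    integral_comp_add_mul_prodWave (W := fun ζ => ((‖ζ‖ ^ s : ℝ) : ℂ)) x hi] at key
  simp_rw [← fourier_mul_eq] at key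
  exact key

theorem conj_wave (x ξ : E) : (starRingEnd ℂ) (wave x ξ) = wave (-x) ξ := by
  rw [wave, wave, ← Circle.coe_inv_eq_conj, inner_neg_right, AddChar.map_neg_eq_inv]

theorem wave_neg_neg (x ξ : E) : wave (-x) (-ξ) = wave x ξ := by
  simp [wave]

theorem conj_fourier_ofReal (u : E → ℝ) (ξ : E) :
    (starRingEnd ℂ) (𝓕 (fun y => (u y : ℂ)) ξ) = 𝓕 (fun y => (u y : ℂ)) (-ξ) := by
  rw [fourier_eq_wave, fourier_eq_wave, ← integral_conj]
  congr 1; ext z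
  rw [map_mul, Complex.conj_ofReal, conj_wave, ← wave_neg_neg, neg_neg]

theorem ofReal_re_fourierInv_freqPow (s : ℝ) (u : E → ℝ) (x : E) :
    (((𝓕⁻ (freqPow s (𝓕 fun y => (u y : ℂ))) x).re : ℝ) : ℂ)
      = 𝓕⁻ (freqPow s (𝓕 fun y => (u y : ℂ))) x := by
  rw [← Complex.conj_eq_iff_re, fourierInv_eq_wave, ← integral_conj, ← integral_neg_eq_self]
  congr 1; ext ξ
  simp only [freqPow, map_mul, Complex.conj_ofReal, conj_wave, wave_neg_neg, conj_fourier_ofReal,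
    norm_neg, neg_neg]

end Spectrum

section Product

/-- A real Schwartz function viewed as a complex one. -/
noncomputable def complexify {E : Type*} [NormedAddCommGroup E] [NormedSpace ℝ E] (u : 𝓢(E, ℝ)) :
    𝓢(E, ℂ) :=
  u.postcompCLM Complex.ofRealCLM

variable {N : ℕ}

theorem enorm_LamF (s : ℝ) (f : EuclideanSpace ℝ (Fin N) → ℝ) (x : EuclideanSpace ℝ (Fin N)) :
    ‖LamF N s f x‖ₑ = ‖𝓕⁻ (freqPow s (𝓕 fun y => (f y : ℂ))) x‖ₑ := by
  rw [← ofReal_re_fourierInv_freqPow, ← ofReal_norm, ← ofReal_norm,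
    Complex.norm_real]
  rfl

theorem exists_enorm_LamF_mul_le (N : ℕ) {s : ℝ} (hs : 1 ≤ s) : ∃ C : ℝ≥0∞, C ≠ ∞ ∧
    ∀ (u v : 𝓢(EuclideanSpace ℝ (Fin N), ℝ)) (x : EuclideanSpace ℝ (Fin N)),
      ‖LamF N s (fun y => u y * v y) x‖ₑ ≤
        (‖v x‖ₑ * ‖LamF N s u x‖ₑ + ‖u x‖ₑ * ‖LamF N s v x‖ₑ) +
        C * (paraSum s (fun y => ‖u y‖ₑ) (fun y => ‖LamF N s u y‖ₑ)
            (fun y => ‖v y‖ₑ) (fun y => ‖LamF N s v y‖ₑ) x +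
          paraSum s (fun y => ‖v y‖ₑ) (fun y => ‖LamF N s v y‖ₑ)
            (fun y => ‖u y‖ₑ) (fun y => ‖LamF N s u y‖ₑ) x) := by
  obtain ⟨C, hC, h⟩ := exists_enorm_leibniz_le_paraSum (E := EuclideanSpace ℝ (Fin N)) hs
  refine ⟨C, hC, fun u v x => ?_⟩
  have hs0 : 0 ≤ s := by linarith
  have key := h (𝓕 ⇑(complexify u)) (𝓕 ⇑(complexify v))
    (integrable_fourier_schwartz _) (integrable_freqPow_fourier_schwartz hs0 _)
    (integrable_fourier_schwartz _) (integrable_freqPow_fourier_schwartz hs0 _) x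
  have hn : ∀ (w : 𝓢(EuclideanSpace ℝ (Fin N), ℝ)) y, ‖complexify w y‖ₑ = ‖w y‖ₑ := fun w y => by
    rw [← ofReal_norm, ← ofReal_norm]
    exact congrArg _ (Complex.norm_real _)
  have hL : ∀ (w : 𝓢(EuclideanSpace ℝ (Fin N), ℝ)) y,
      ‖𝓕⁻ (freqPow s (𝓕 ⇑(complexify w))) y‖ₑ = ‖LamF N s w y‖ₑ := fun w y =>
    (enorm_LamF s w y).symm
  have hL2 : ‖LamF N s (fun y => u y * v y) x‖ₑ
      = ‖𝓕⁻ (freqPow s (𝓕 fun y => complexify u y * complexify v y)) x‖ₑ := by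
    rw [enorm_LamF]
    simp only [Complex.ofReal_mul]
    rfl
  simp only [fourierInv_fourier_schwartz, hn, hL] at key
  rw [hL2, fourierInv_freqPow_fourier_mul hs0]
  refine (enorm_add_le _ _).trans (add_le_add ((enorm_add_le _ _).trans (le_of_eq ?_)) key)
  rw [enorm_mul, enorm_mul, hn, hn, hL, hL, mul_comm ‖v x‖ₑ]

theorem measurable_LamF (s : ℝ) (hs : 0 ≤ s) (u : 𝓢(EuclideanSpace ℝ (Fin N), ℝ)) :
    Measurable (LamF N s u) :=
  Complex.continuous_re.measurable.comp
    (continuous_fourierInv (integrable_freqPow_fourier_schwartz hs (complexify u))).measurable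

theorem exists_recipNorm_LamF_mul_le (N : ℕ) {s a b : ℝ} (hs : 1 ≤ s) (ha : 0 ≤ a) (hb : 0 < b)
    (hab : a + b < 1) : ∃ C : ℝ≥0∞, C ≠ ∞ ∧ ∀ u v : 𝓢(EuclideanSpace ℝ (Fin N), ℝ),
      recipNorm (a + b) (fun x => ‖LamF N s (fun y => u y * v y) x‖ₑ) ≤
        C * (recipNorm a (fun x => ‖u x‖ₑ) * recipNorm b (fun x => ‖LamF N s v x‖ₑ) +
          recipNorm a (fun x => ‖v x‖ₑ) * recipNorm b (fun x => ‖LamF N s u x‖ₑ)) := by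
  obtain ⟨C, hC, h⟩ := exists_enorm_LamF_mul_le N hs
  obtain ⟨D, hD, hp⟩ := exists_recipNorm_paraSum_le (E := EuclideanSpace ℝ (Fin N)) ha hb hab hs
  refine ⟨1 + C * (D + D), by finiteness, fun u v => ?_⟩
  have hs0 : 0 ≤ s := by linarith
  have hab0 : 0 < a + b := by linarith
  have mu := u.continuous.measurable.enorm
  have mv := v.continuous.measurable.enorm
  have mu' := (measurable_LamF s hs0 u).enorm
  have mv' := (measurable_LamF s hs0 v).enorm
  have mp := measurable_paraSum s mu mu' mv mv'
  have mp' := measurable_paraSum s mv mv' mu mu'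
  set U := fun x => ‖u x‖ₑ
  set V := fun x => ‖v x‖ₑ
  set U' := fun x => ‖LamF N s u x‖ₑ
  set V' := fun x => ‖LamF N s v x‖ₑ
  set R := recipNorm a U * recipNorm b V' + recipNorm a V * recipNorm b U' with hR
  calc _ ≤ recipNorm (a + b) (fun x => (V x * U' x + U x * V' x) +
        C * (paraSum s U U' V V' x + paraSum s V V' U U' x)) := recipNorm_mono hab0.le (h u v)
    _ ≤ recipNorm (a + b) (fun x => V x * U' x + U x * V' x) +
        recipNorm (a + b) (fun x => C * (paraSum s U U' V V' x + paraSum s V V' U U' x)) :=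
        recipNorm_add_le hab0 hab.le ((mv.mul mu').add (mu.mul mv')) ((mp.add mp').const_mul C)
    _ ≤ (recipNorm (a + b) (fun x => V x * U' x) + recipNorm (a + b) (fun x => U x * V' x)) +
        C * (recipNorm (a + b) (paraSum s U U' V V') + recipNorm (a + b) (paraSum s V V' U U')) := by
        rw [recipNorm_const_mul hab0 C hC]
        exact add_le_add (recipNorm_add_le hab0 hab.le (mv.mul mu') (mu.mul mv'))
          (mul_le_mul' le_rfl (recipNorm_add_le hab0 hab.le mp mp'))
    _ ≤ (recipNorm a V * recipNorm b U' + recipNorm a U * recipNorm b V') +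
        C * (D * R + D * (recipNorm a V * recipNorm b U' + recipNorm a U * recipNorm b V')) :=
        add_le_add (add_le_add (recipNorm_mul_le ha hb mv mu') (recipNorm_mul_le ha hb mu mv'))
          (mul_le_mul' le_rfl (add_le_add (hp _ _ _ _ mu mu' mv mv') (hp _ _ _ _ mv mv' mu mu')))
    _ = _ := by rw [hR]; ring

end Product

/-- **product estimate.** Let `N ≥ 1`, `s ≥ 1`, `1 < r < p ≤ ∞`,
`1 < q < ∞` with `1/p + 1/q = 1/r`.  Then there is `C > 0` such that for all
`u, v ∈ S(ℝ^N)`: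
`‖Λ^s(uv)‖_{L^r} ≤ C(‖u‖_{L^p} ‖Λ^s v‖_{L^q} + ‖v‖_{L^p} ‖Λ^s u‖_{L^q})`. -/
theorem statement5 (N : ℕ) (hN : 1 ≤ N) (s : ℝ) (hs : 1 ≤ s)
    (r p q : ℝ≥0∞) (hr : 1 < r) (hrp : r < p) (hq1 : 1 < q) (hq2 : q < ⊤)
    (hpqr : 1 / p + 1 / q = 1 / r) :
    ∃ C : ℝ, 0 < C ∧ ∀ u v : SchwartzMap (EuclideanSpace ℝ (Fin N)) ℝ,
      eLpNorm (LamF N s (fun x => u x * v x)) r volume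
        ≤ ENNReal.ofReal C *
          (eLpNorm (⇑u) p volume * eLpNorm (LamF N s (⇑v)) q volume
            + eLpNorm (⇑v) p volume * eLpNorm (LamF N s (⇑u)) q volume) := by
  have hr0 : r ≠ 0 := (zero_lt_one.trans hr).ne'
  have hp0 : p ≠ 0 := (zero_lt_one.trans (hr.trans hrp)).ne'
  have hq0 : q ≠ 0 := (zero_lt_one.trans hq1).ne'
  have hsum : (p⁻¹).toReal + (q⁻¹).toReal = (r⁻¹).toReal := by
    rw [← ENNReal.toReal_add (ENNReal.inv_ne_top.2 hp0) (ENNReal.inv_ne_top.2 hq0)]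
    simpa only [one_div] using congrArg ENNReal.toReal hpqr
  have hb : 0 < (q⁻¹).toReal :=
    ENNReal.toReal_pos (ENNReal.inv_ne_zero.2 hq2.ne) (ENNReal.inv_ne_top.2 hq0)
  have hlt : (p⁻¹).toReal + (q⁻¹).toReal < 1 := by
    rw [hsum]
    simpa using (ENNReal.toReal_lt_toReal (ENNReal.inv_ne_top.2 hr0) ENNReal.one_ne_top).2
      (ENNReal.inv_lt_one.2 hr)
  obtain ⟨C, hC, h⟩ := exists_recipNorm_LamF_mul_le N hs (ENNReal.toReal_nonneg (a := p⁻¹)) hb hlt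
  refine ⟨C.toReal + 1, by positivity, fun u v => ?_⟩
  have := h u v
  rw [hsum] at this
  rw [eLpNorm_eq_recipNorm r hr0, eLpNorm_eq_recipNorm p hp0, eLpNorm_eq_recipNorm p hp0,
    eLpNorm_eq_recipNorm q hq0, eLpNorm_eq_recipNorm q hq0]
  refine this.trans (mul_le_mul' ?_ le_rfl)
  rw [← ENNReal.ofReal_toReal hC]
  exact ENNReal.ofReal_le_ofReal (by simp)
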